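/- arXiv:2503.18564 — 11 statements merged into one kernel-verified Lean document; each statement's English description precedes it below -/
import Mathlib

section
/- Let G be a finite group and let (r₀, r₁, r₂) and (r̃₀, r̃₁, r̃₂) both be regular linear hypermap triples for G. Then there exists a bijection σ : G → G satisfying σ(g·rᵢ) = σ(g)·r̃ᵢ for all g ∈ G and all i ∈ {0,1,2} if and only if there exists a group automorphism τ of G with τ(rᵢ) = r̃ᵢ for all i ∈ {0,1,2}. -/
open Pointwise

/-- `(r₀, r₁, r₂)` is a regular linear hypermap triple for the group `G`:
the `rᵢ` are pairwise distinct involutions generating `G`, with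
`⟨r₁,r₂⟩ ⊓ ⟨r₀,r₂⟩ = ⟨r₂⟩` and `⟨r₁,r₂⟩⟨r₀,r₂⟩ ∩ ⟨r₀,r₂⟩⟨r₁,r₂⟩ = ⟨r₁,r₂⟩ ∪ ⟨r₀,r₂⟩`. -/
def IsRLHTriple {G : Type*} [Group G] (r₀ r₁ r₂ : G) : Prop :=
  orderOf r₀ = 2 ∧ orderOf r₁ = 2 ∧ orderOf r₂ = 2 ∧
  r₀ ≠ r₁ ∧ r₀ ≠ r₂ ∧ r₁ ≠ r₂ ∧
  Subgroup.closure {r₀, r₁, r₂} = (⊤ : Subgroup G) ∧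
  Subgroup.closure {r₁, r₂} ⊓ Subgroup.closure {r₀, r₂} = Subgroup.closure {r₂} ∧
  ((Subgroup.closure {r₁, r₂} : Set G) * (Subgroup.closure {r₀, r₂} : Set G)) ∩
      ((Subgroup.closure {r₀, r₂} : Set G) * (Subgroup.closure {r₁, r₂} : Set G)) =
    (Subgroup.closure {r₁, r₂} : Set G) ∪ (Subgroup.closure {r₀, r₂} : Set G)

/-- If right multiplication by each element of a generating set is intertwined by `f` with some
right multiplication, then the same holds for every element of the group. -/
theorem exists_map_mul_right_of_closure_eq_top {G H : Type*} [Group G] [Group H] {S : Set G}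
    (hS : Subgroup.closure S = ⊤) (f : G → H)
    (hf : ∀ s ∈ S, ∃ t : H, ∀ g : G, f (g * s) = f g * t) (x : G) :
    ∃ t : H, ∀ g : G, f (g * x) = f g * t := by
  have hx : x ∈ Subgroup.closure S := hS ▸ Subgroup.mem_top x
  induction hx using Subgroup.closure_induction with
  | mem s hs => exact hf s hs
  | one => exact ⟨1, fun g => by simp⟩
  | mul x y _ _ hx hy =>
    obtain ⟨t, ht⟩ := hx
    obtain ⟨u, hu⟩ := hy
    exact ⟨t * u, fun g => by rw [← mul_assoc, hu, ht, mul_assoc]⟩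
  | inv x _ hx =>
    obtain ⟨t, ht⟩ := hx
    exact ⟨t⁻¹, fun g => by rw [eq_mul_inv_iff_mul_eq, ← ht, inv_mul_cancel_right]⟩

theorem stmt_4 {G : Type*} [Group G] [Fintype G] (r₀ r₁ r₂ r₀' r₁' r₂' : G)
    (h : IsRLHTriple r₀ r₁ r₂) (h' : IsRLHTriple r₀' r₁' r₂') :
    (∃ σ : G ≃ G,
        (∀ g : G, σ (g * r₀) = σ g * r₀') ∧
        (∀ g : G, σ (g * r₁) = σ g * r₁') ∧
        (∀ g : G, σ (g * r₂) = σ g * r₂')) ↔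
    (∃ τ : G ≃* G, τ r₀ = r₀' ∧ τ r₁ = r₁' ∧ τ r₂ = r₂') := by
  constructor
  · rintro ⟨σ, h₀, h₁, h₂⟩
    have hσ (x y : G) : σ (x * y) = σ x * ((σ 1)⁻¹ * σ y) := by
      obtain ⟨t, ht⟩ := exists_map_mul_right_of_closure_eq_top h.2.2.2.2.2.2.1 σ
        (by
          rintro s (rfl | rfl | rfl)
          exacts [⟨r₀', h₀⟩, ⟨r₁', h₁⟩, ⟨r₂', h₂⟩]) y
      rw [ht, ← one_mul y, ht, inv_mul_cancel_left]
    have hτ {r r' : G} (hr : ∀ g : G, σ (g * r) = σ g * r') : (σ 1)⁻¹ * σ r = r' := by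
      rw [← one_mul r, hr, inv_mul_cancel_left]
    exact ⟨{ σ.trans (Equiv.mulLeft (σ 1)⁻¹) with
      map_mul' := fun x y => by simp [hσ x y, mul_assoc] }, hτ h₀, hτ h₁, hτ h₂⟩
  · rintro ⟨τ, rfl, rfl, rfl⟩
    exact ⟨τ.toEquiv, fun g => map_mul τ g r₀, fun g => map_mul τ g r₁, fun g => map_mul τ g r₂⟩
end

section
/- Let G be a finite group and let (r₀, r₁, r₂) be a regular linear hypermap triple for G. Then the normal core of the subgroup H = ⟨r₁, r₂⟩ in G is contained in ⟨r₂⟩; in particular, the core is either the trivial subgroup or equal to ⟨r₂⟩. -/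
open Pointwise

theorem Subgroup.mem_closure_singleton_iff_of_orderOf_eq_two {G : Type*} [Group G] {r x : G}
    (hr : orderOf r = 2) : x ∈ Subgroup.closure {r} ↔ x = 1 ∨ x = r := by
  have hr2 : r ^ 2 = 1 := hr ▸ pow_orderOf_eq_one r
  rw [Subgroup.mem_closure_singleton]
  constructor
  · rintro ⟨n, rfl⟩
    obtain ⟨k, rfl | rfl⟩ := Int.even_or_odd' n
    · left
      rw [zpow_mul, zpow_ofNat, hr2, one_zpow]
    · right
      rw [zpow_add, zpow_mul, zpow_ofNat, hr2, one_zpow, one_mul, zpow_one]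
  · rintro (rfl | rfl)
    · exact ⟨0, zpow_zero r⟩
    · exact ⟨1, zpow_one x⟩

/-- If `HK ∩ KH` is covered by `H` and `K`, and `K` is not contained in `H`, then `K` contains
every normal subgroup contained in `H`. -/
theorem Subgroup.normalCore_le_of_mul_inter_mul_subset {G : Type*} [Group G] {H K : Subgroup G}
    (hHK : ((H : Set G) * K) ∩ ((K : Set G) * H) ⊆ (H : Set G) ∪ K) (hK : ¬ K ≤ H) :
    H.normalCore ≤ K := by
  obtain ⟨k, hkK, hkH⟩ := SetLike.not_le_iff_exists.mp hK
  intro n hn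
  have hnH : n ∈ H := H.normalCore_le hn
  have hconj : k⁻¹ * n * k ∈ H :=
    H.normalCore_le (by simpa using H.normalCore_normal.conj_mem n hn k⁻¹)
  have hmem : n * k ∈ ((H : Set G) * K) ∩ ((K : Set G) * H) :=
    ⟨Set.mul_mem_mul hnH hkK, k, hkK, k⁻¹ * n * k, hconj, by group⟩
  rcases hHK hmem with h | h
  · exact absurd ((H.mul_mem_cancel_left hnH).mp h) hkH
  · exact (K.mul_mem_cancel_right hkK).mp h

theorem stmt_5 {G : Type*} [Group G] [Fintype G] (r₀ r₁ r₂ : G)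
    (h : IsRLHTriple r₀ r₁ r₂) :
    (Subgroup.closure {r₁, r₂}).normalCore ≤ Subgroup.closure {r₂} ∧
    ((Subgroup.closure {r₁, r₂}).normalCore = ⊥ ∨
      (Subgroup.closure {r₁, r₂}).normalCore = Subgroup.closure ({r₂} : Set G)) := by
  obtain ⟨h0, -, h2, -, h02, -, -, hinf, hmul⟩ := h
  have hr₀ : r₀ ∈ Subgroup.closure {r₀, r₂} := Subgroup.subset_closure (by simp)
  have hK : ¬ Subgroup.closure {r₀, r₂} ≤ Subgroup.closure {r₁, r₂} := by
    intro hle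
    have hr : r₀ ∈ Subgroup.closure {r₂} := hinf ▸ Subgroup.mem_inf.mpr ⟨hle hr₀, hr₀⟩
    rcases (Subgroup.mem_closure_singleton_iff_of_orderOf_eq_two h2).mp hr with rfl | rfl
    · simp at h0
    · exact h02 rfl
  have hle : (Subgroup.closure {r₁, r₂}).normalCore ≤ Subgroup.closure {r₂} :=
    hinf ▸ le_inf (Subgroup.normalCore_le _)
      (Subgroup.normalCore_le_of_mul_inter_mul_subset hmul.subset hK)
  refine ⟨hle, or_iff_not_imp_left.mpr fun hne => le_antisymm hle ?_⟩
  obtain ⟨n, hn, hn1⟩ := (Subgroup.bot_or_exists_ne_one _).resolve_left hne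
  have hn2 : n = r₂ :=
    ((Subgroup.mem_closure_singleton_iff_of_orderOf_eq_two h2).mp (hle hn)).resolve_left hn1
  rw [Subgroup.closure_le, Set.singleton_subset_iff]
  exact hn2 ▸ hn
end

section
/- Let G be a finite group and let (r₀, r₁, r₂) be a regular linear hypermap triple for G such that the normal core of ⟨r₁, r₂⟩ in G equals ⟨r₂⟩ and r₂ ∉ ⟨r₀, r₁⟩. Then r₂ commutes with both r₀ and r₁, the order n of r₀r₁ satisfies n ≥ 3, and G is isomorphic to the direct product C₂ × D_{2n} of a cyclic group of order 2 with the dihedral group of order 2n (generated by the two reflections r₀ and r₁). -/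
open Pointwise

theorem mem_closure_singleton_of_orderOf_eq_two {G : Type*} [Group G] {a x : G}
    (ha : orderOf a = 2) : x ∈ Subgroup.closure ({a} : Set G) ↔ x = 1 ∨ x = a := by
  rw [← Subgroup.zpowers_eq_closure]
  constructor
  · rintro ⟨k, rfl⟩
    have hsq : a ^ (2 : ℤ) = 1 := by exact_mod_cast ha ▸ pow_orderOf_eq_one a
    rcases Int.even_or_odd' k with ⟨m, rfl | rfl⟩
    · exact Or.inl (by simp [zpow_mul, hsq])
    · exact Or.inr (by simp [zpow_add, zpow_mul, hsq])
  · rintro (rfl | rfl)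
    · exact one_mem _
    · exact Subgroup.mem_zpowers x

theorem commute_of_normal_closure_singleton {G : Type*} [Group G] {a : G} (ha : orderOf a = 2)
    (hN : (Subgroup.closure ({a} : Set G)).Normal) (g : G) : Commute a g := by
  have hmem := hN.conj_mem a (Subgroup.subset_closure rfl) g
  rcases (mem_closure_singleton_of_orderOf_eq_two ha).1 hmem with hc | hc
  · have h1 : a = 1 := by simpa using hc
    simp [h1] at ha
  · exact (mul_inv_eq_iff_eq_mul.1 hc).symm

/-- Powers of `a` indexed by residues modulo its order. -/
noncomputable def zmodPowHom {G : Type*} [Group G] (a : G) :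
    ZMod (orderOf a) →+ Additive G :=
  ZMod.lift (orderOf a) ⟨zmultiplesHom (Additive G) (Additive.ofMul a), by
    simp [← ofMul_pow, pow_orderOf_eq_one]⟩

theorem zmodPowHom_intCast {G : Type*} [Group G] (a : G) (k : ℤ) :
    (zmodPowHom a k).toMul = a ^ k := by
  simp [zmodPowHom]

/-- The homomorphism from a dihedral group determined by a reflection `s` inverting `a`. -/
noncomputable def dihedralLift {G : Type*} [Group G] (s a : G) (hs : s * s = 1)
    (hsa : SemiconjBy s a a⁻¹) : DihedralGroup (orderOf a) →* G :=
  have key (i : ZMod (orderOf a)) :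
      s * (zmodPowHom a i).toMul = (zmodPowHom a (-i)).toMul * s := by
    obtain ⟨k, rfl⟩ := ZMod.intCast_surjective i
    rw [← Int.cast_neg, zmodPowHom_intCast, zmodPowHom_intCast, zpow_neg, ← inv_zpow]
    exact hsa.zpow_right k
  MonoidHom.mk' (fun
    | .r i => (zmodPowHom a i).toMul
    | .sr i => s * (zmodPowHom a i).toMul) (by
    rintro (i | i) (j | j)
    · simp
    · have hi := key (-i)
      rw [neg_neg] at hi
      simp only [DihedralGroup.r_mul_sr]
      rw [← mul_assoc, ← hi, mul_assoc, ← toMul_add, ← map_add, neg_add_eq_sub]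
    · simp [mul_assoc]
    · simp only [DihedralGroup.sr_mul_sr]
      rw [key i, mul_assoc, ← mul_assoc s, hs, one_mul, ← toMul_add, ← map_add,
        neg_add_eq_sub])

theorem dihedralLift_r {G : Type*} [Group G] (s a : G) (hs : s * s = 1)
    (hsa : SemiconjBy s a a⁻¹) (k : ℤ) : dihedralLift s a hs hsa (.r k) = a ^ k :=
  zmodPowHom_intCast a k

theorem dihedralLift_sr {G : Type*} [Group G] (s a : G) (hs : s * s = 1)
    (hsa : SemiconjBy s a a⁻¹) (k : ℤ) : dihedralLift s a hs hsa (.sr k) = s * a ^ k :=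
  congrArg (s * ·) (zmodPowHom_intCast a k)

theorem dihedralLift_mem_closure {G : Type*} [Group G] (s a : G) (hs : s * s = 1)
    (hsa : SemiconjBy s a a⁻¹) (d : DihedralGroup (orderOf a)) :
    dihedralLift s a hs hsa d ∈ Subgroup.closure ({s, a} : Set G) := by
  have hs' : s ∈ Subgroup.closure ({s, a} : Set G) := Subgroup.subset_closure (by simp)
  have ha' : a ∈ Subgroup.closure ({s, a} : Set G) := Subgroup.subset_closure (by simp)
  rcases d with i | i <;> obtain ⟨k, rfl⟩ := ZMod.intCast_surjective i
  · rw [dihedralLift_r]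
    exact zpow_mem ha' k
  · rw [dihedralLift_sr]
    exact mul_mem hs' (zpow_mem ha' k)

theorem dihedralLift_injective {G : Type*} [Group G] (s a : G) (hs : s * s = 1)
    (hsa : SemiconjBy s a a⁻¹) (hcomm : ¬ Commute s a) :
    Function.Injective (dihedralLift s a hs hsa) := by
  refine (injective_iff_map_eq_one _).2 ?_
  rintro (i | i) hi <;> obtain ⟨k, rfl⟩ := ZMod.intCast_surjective i
  · rw [dihedralLift_r, ← orderOf_dvd_iff_zpow_eq_one, ← ZMod.intCast_zmod_eq_zero_iff_dvd] at hi
    rw [hi, DihedralGroup.r_zero]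
  · rw [dihedralLift_sr] at hi
    rw [eq_inv_of_mul_eq_one_left hi] at hcomm
    exact absurd ((Commute.refl a).zpow_left k).inv_left hcomm

theorem IsRLHTriple.not_commute {G : Type*} [Group G] {r₀ r₁ r₂ : G}
    (h : IsRLHTriple r₀ r₁ r₂) : ¬ Commute r₀ r₁ := by
  obtain ⟨h0, h1, h2, -, h02, h12, -, hinf, hset⟩ := h
  intro hc
  have m0 : r₀ ∈ Subgroup.closure ({r₀, r₂} : Set G) := Subgroup.subset_closure (by simp)
  have m1 : r₁ ∈ Subgroup.closure ({r₁, r₂} : Set G) := Subgroup.subset_closure (by simp)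
  have hmem := hset.subset
    ⟨Set.mul_mem_mul m1 m0, hc.eq ▸ Set.mul_mem_mul m0 m1⟩
  have not_both (x : G) (hx : orderOf x = 2) (hx2 : x ≠ r₂)
      (hl : x ∈ Subgroup.closure ({r₁, r₂} : Set G))
      (hr : x ∈ Subgroup.closure ({r₀, r₂} : Set G)) : False := by
    rcases (mem_closure_singleton_of_orderOf_eq_two h2).1
      (hinf.le ⟨hl, hr⟩) with rfl | rfl
    · simp at hx
    · exact hx2 rfl
  rcases hmem with hm | hm
  · exact not_both r₀ h0 h02 ((Subgroup.mul_mem_cancel_left _ m1).1 hm) m0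
  · exact not_both r₁ h1 h12 m1 ((Subgroup.mul_mem_cancel_right _ m0).1 hm)

theorem three_le_orderOf_mul_of_not_commute {G : Type*} [Group G] [Finite G] {a b : G}
    (ha : a * a = 1) (hb : b * b = 1) (hc : ¬ Commute a b) : 3 ≤ orderOf (a * b) := by
  by_contra! hlt
  have hpos := orderOf_pos (a * b)
  have hsq : (a * b) * (a * b) = 1 := by
    rw [← pow_two]
    apply orderOf_dvd_iff_pow_eq_one.1
    interval_cases orderOf (a * b) <;> norm_num
  apply hc
  have := eq_inv_of_mul_eq_one_left hsq
  rwa [mul_inv_rev, ← eq_inv_of_mul_eq_one_left ha, ← eq_inv_of_mul_eq_one_left hb] at this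

theorem stmt_6 {G : Type*} [Group G] [Fintype G] (r₀ r₁ r₂ : G)
    (h : IsRLHTriple r₀ r₁ r₂)
    (hcore : (Subgroup.closure {r₁, r₂}).normalCore = Subgroup.closure ({r₂} : Set G))
    (hr₂ : r₂ ∉ Subgroup.closure ({r₀, r₁} : Set G)) :
    Commute r₂ r₀ ∧ Commute r₂ r₁ ∧ 3 ≤ orderOf (r₀ * r₁) ∧
    Nonempty (G ≃* Multiplicative (ZMod 2) × DihedralGroup (orderOf (r₀ * r₁))) := by
  have hnc := h.not_commute
  obtain ⟨h0, h1, h2, -, -, -, htop, -, -⟩ := h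
  have sq {x : G} (hx : orderOf x = 2) : x * x = 1 := by
    rw [← pow_two, ← hx, pow_orderOf_eq_one]
  have inv_eq {x : G} (hx : orderOf x = 2) : x⁻¹ = x :=
    (eq_inv_of_mul_eq_one_left (sq hx)).symm
  have central : ∀ g, Commute r₂ g :=
    commute_of_normal_closure_singleton h2 (hcore ▸ inferInstance)
  refine ⟨central r₀, central r₁,
    three_le_orderOf_mul_of_not_commute (sq h0) (sq h1) hnc, ?_⟩
  have hsa : SemiconjBy r₀ (r₀ * r₁) (r₀ * r₁)⁻¹ := by
    rw [SemiconjBy, mul_inv_rev, inv_eq h0, inv_eq h1, ← mul_assoc, sq h0, mul_assoc, sq h0]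
    simp
  have hnc' : ¬ Commute r₀ (r₀ * r₁) := fun hc => hnc (by
    have := (Commute.refl r₀).inv_right.mul_right hc
    simpa using this)
  let f := dihedralLift r₀ (r₀ * r₁) (sq h0) hsa
  let e : Multiplicative (ZMod 2) →* G := AddMonoidHom.toMultiplicativeLeft
    ((zmodPowHom r₂).comp (ZMod.ringEquivCongr h2.symm).toAddMonoidHom)
  have he (k : ℤ) : e (.ofAdd (k : ZMod 2)) = r₂ ^ k := by
    rw [← zmodPowHom_intCast]
    simp [e]
  have he1 : e (.ofAdd 1) = r₂ := by simpa using he 1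
  have hcomm (x : Multiplicative (ZMod 2)) (d) : Commute (e x) (f d) := by
    obtain ⟨k, hk⟩ := ZMod.intCast_surjective x.toAdd
    rw [← ofAdd_toAdd x, ← hk, he]
    exact (central _).zpow_left k
  let F := e.noncommCoprod f hcomm
  have hF : Function.Bijective F := by
    constructor
    · refine (injective_iff_map_eq_one _).2 ?_
      rintro ⟨x, d⟩ hxd
      have hxd : e x * f d = 1 := hxd
      have hfmem : f d ∈ Subgroup.closure ({r₀, r₁} : Set G) := by
        refine (Subgroup.closure_le _).2 ?_ (dihedralLift_mem_closure r₀ (r₀ * r₁) (sq h0) hsa d)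
        have m0 : r₀ ∈ Subgroup.closure ({r₀, r₁} : Set G) := Subgroup.subset_closure (by simp)
        have m1 : r₁ ∈ Subgroup.closure ({r₀, r₁} : Set G) := Subgroup.subset_closure (by simp)
        rintro y (rfl | rfl)
        exacts [m0, mul_mem m0 m1]
      have hx : x = 1 ∨ x = .ofAdd 1 :=
        (by decide : ∀ y : Multiplicative (ZMod 2), y = 1 ∨ y = .ofAdd 1) x
      rcases hx with rfl | rfl
      · rw [map_one, one_mul] at hxd
        rw [dihedralLift_injective r₀ (r₀ * r₁) (sq h0) hsa hnc' (hxd.trans (map_one f).symm)]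
        rfl
      · rw [he1] at hxd
        exact absurd (eq_inv_of_mul_eq_one_left hxd ▸ inv_mem hfmem) hr₂
    · rw [← MonoidHom.range_eq_top, eq_top_iff, ← htop, Subgroup.closure_le]
      have hf0 : f (.sr 0) = r₀ := by
        simpa using dihedralLift_sr r₀ (r₀ * r₁) (sq h0) hsa 0
      have hf1 : f (.sr 1) = r₁ := by
        simpa [← mul_assoc, sq h0] using dihedralLift_sr r₀ (r₀ * r₁) (sq h0) hsa 1
      rintro y (rfl | rfl | rfl)
      · exact ⟨(1, .sr 0), by simp [F, hf0]⟩
      · exact ⟨(1, .sr 1), by simp [F, hf1]⟩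
      · exact ⟨(.ofAdd 1, 1), by simp [F, he1]⟩
  exact ⟨(MulEquiv.ofBijective F hF).symm⟩
end

section
/- Let G be a finite group and let (r₀, r₁, r₂) be a regular linear hypermap triple for G such that the normal core of ⟨r₁, r₂⟩ in G equals ⟨r₂⟩ and r₂ ∈ ⟨r₀, r₁⟩. Then G = ⟨r₀, r₁⟩, the order m of r₀r₁ is even and satisfies m ≥ 6, r₂ = (r₀r₁)^{m/2}, and G is isomorphic to the dihedral group D_{2m} of order 2m. -/
open Pointwise

section DihedralGeneration

variable {G : Type*} [Group G] {a b : G}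

theorem zpow_cast_intCast_zmod (x : G) (k : ℤ) :
    x ^ (((k : ZMod (orderOf x)).cast : ℤ)) = x ^ k := by
  rw [zpow_eq_zpow_iff_modEq, ← ZMod.intCast_eq_intCast_iff, ZMod.intCast_cast, ZMod.cast_id]

theorem mul_zpow_mul_eq_zpow_neg_mul (ha : a * a = 1) (hb : b * b = 1) (k : ℤ) :
    (a * b) ^ k * a = a * (a * b) ^ (-k) := by
  have hconj : a * (a * b) * a⁻¹ = (a * b)⁻¹ := by
    rw [mul_inv_rev, ← eq_inv_of_mul_eq_one_left ha, ← eq_inv_of_mul_eq_one_left hb,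
      ← mul_assoc, ha, one_mul]
  have h := conj_zpow (i := -k) (a := a) (b := a * b)
  rw [hconj, inv_zpow', neg_neg] at h
  rw [h]
  group

/-- The homomorphism from a dihedral group determined by two elements squaring to one. -/
noncomputable def dihedralHom (ha : a * a = 1) (hb : b * b = 1) : DihedralGroup (orderOf (a * b)) →* G :=
  MonoidHom.mk'
    (fun x => match x with
      | .r i => (a * b) ^ (i.cast : ℤ)
      | .sr i => a * (a * b) ^ (i.cast : ℤ))
    (by
      rintro (i | i) (j | j) <;>
      obtain ⟨i, rfl⟩ := ZMod.intCast_surjective i <;>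
      obtain ⟨j, rfl⟩ := ZMod.intCast_surjective j <;>
      simp only [DihedralGroup.r_mul_r, DihedralGroup.r_mul_sr, DihedralGroup.sr_mul_r,
        DihedralGroup.sr_mul_sr, ← Int.cast_add, ← Int.cast_sub, zpow_cast_intCast_zmod]
      · rw [zpow_add]
      · rw [← mul_assoc, mul_zpow_mul_eq_zpow_neg_mul ha hb, mul_assoc, ← zpow_add,
          neg_add_eq_sub]
      · rw [zpow_add, mul_assoc]
      · rw [mul_assoc, ← mul_assoc _ a, mul_zpow_mul_eq_zpow_neg_mul ha hb, mul_assoc,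
          ← mul_assoc, ha, one_mul, ← zpow_add, neg_add_eq_sub])

theorem dihedralHom_r (ha : a * a = 1) (hb : b * b = 1) (k : ℤ) :
    dihedralHom ha hb (.r k) = (a * b) ^ k :=
  zpow_cast_intCast_zmod _ _

theorem dihedralHom_sr (ha : a * a = 1) (hb : b * b = 1) (k : ℤ) :
    dihedralHom ha hb (.sr k) = a * (a * b) ^ k :=
  congrArg (a * ·) (zpow_cast_intCast_zmod _ _)

theorem mul_mul_self_eq_one_of_commute (ha : a * a = 1) (hb : b * b = 1)
    (h : Commute a (a * b)) : (a * b) * (a * b) = 1 := by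
  rw [← mul_assoc, ← h.eq, ← mul_assoc, ha, one_mul, hb]

theorem zpow_eq_one_or_self_of_mul_self {x : G} (hx : x * x = 1) (k : ℤ) :
    x ^ k = 1 ∨ x ^ k = x := by
  have h2 (n : ℤ) : x ^ (2 * n) = 1 := by rw [zpow_mul, zpow_two, hx, one_zpow]
  obtain ⟨n, rfl | rfl⟩ := Int.even_or_odd' k
  · exact .inl (h2 n)
  · exact .inr (by rw [zpow_add, h2, one_mul, zpow_one])

theorem dihedralHom_injective (ha : a * a = 1) (hb : b * b = 1) (ha1 : a ≠ 1) (hb1 : b ≠ 1) :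
    Function.Injective (dihedralHom ha hb) := by
  rw [injective_iff_map_eq_one]
  rintro (i | i) h <;> obtain ⟨k, rfl⟩ := ZMod.intCast_surjective i
  · rw [dihedralHom_r, ← orderOf_dvd_iff_zpow_eq_one] at h
    rw [(ZMod.intCast_zmod_eq_zero_iff_dvd k _).2 h, DihedralGroup.r_zero]
  · rw [dihedralHom_sr] at h
    have hak : a = (a * b) ^ k := by
      rw [eq_inv_of_mul_eq_one_right h]
      exact eq_inv_of_mul_eq_one_left ha
    have hc : Commute a (a * b) := by
      have := (Commute.refl (a * b)).zpow_left k
      rwa [← hak] at this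
    obtain h1 | h1 := zpow_eq_one_or_self_of_mul_self
      (mul_mul_self_eq_one_of_commute ha hb hc) k
    · exact absurd (hak.trans h1) ha1
    · exact absurd (left_eq_mul.1 (hak.trans h1)) hb1

theorem dihedralHom_range (ha : a * a = 1) (hb : b * b = 1) :
    (dihedralHom ha hb).range = Subgroup.closure {a, b} := by
  have hA : a ∈ Subgroup.closure {a, b} := Subgroup.subset_closure (by simp)
  have hB : b ∈ Subgroup.closure {a, b} := Subgroup.subset_closure (by simp)
  apply le_antisymm
  · rintro _ ⟨i | i, rfl⟩ <;> obtain ⟨k, rfl⟩ := ZMod.intCast_surjective i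
    · rw [dihedralHom_r]
      exact zpow_mem (mul_mem hA hB) k
    · rw [dihedralHom_sr]
      exact mul_mem hA (zpow_mem (mul_mem hA hB) k)
  · rw [Subgroup.closure_le]
    rintro x (rfl | rfl)
    · exact ⟨.sr ((0 : ℤ) : ZMod _), by rw [dihedralHom_sr]; simp⟩
    · exact ⟨.sr ((1 : ℤ) : ZMod _), by rw [dihedralHom_sr, zpow_one, ← mul_assoc, ha, one_mul]⟩

theorem closure_normal_of_conj_mem {s : Set G} {H : Subgroup G}
    (hs : Subgroup.closure s = ⊤) (hinv : ∀ g ∈ s, g * g = 1)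
    (hH : ∀ g ∈ s, ∀ x ∈ H, g * x * g⁻¹ ∈ H) : H.Normal := by
  rw [← Subgroup.normalizer_eq_top_iff, eq_top_iff, ← hs, Subgroup.closure_le]
  intro g hg
  refine Subgroup.mem_normalizer_iff.2 fun x => ⟨hH g hg x, fun hx => ?_⟩
  have h := hH g hg _ hx
  rw [← eq_inv_of_mul_eq_one_left (hinv g hg), mul_assoc, mul_assoc, hinv g hg, mul_one,
    ← mul_assoc, hinv g hg, one_mul] at h
  exact h

end DihedralGeneration

theorem stmt_7 {G : Type*} [Group G] [Fintype G] (r₀ r₁ r₂ : G)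
    (h : IsRLHTriple r₀ r₁ r₂)
    (hcore : (Subgroup.closure {r₁, r₂}).normalCore = Subgroup.closure ({r₂} : Set G))
    (hr₂ : r₂ ∈ Subgroup.closure ({r₀, r₁} : Set G)) :
    Subgroup.closure ({r₀, r₁} : Set G) = ⊤ ∧
    Even (orderOf (r₀ * r₁)) ∧ 6 ≤ orderOf (r₀ * r₁) ∧
    r₂ = (r₀ * r₁) ^ (orderOf (r₀ * r₁) / 2) ∧
    Nonempty (G ≃* DihedralGroup (orderOf (r₀ * r₁))) := by
  obtain ⟨h0, h1, h2, h01, h02, h12, htop, -, -⟩ := h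
  have ne_one : ∀ {x : G}, orderOf x = 2 → x ≠ 1 := by
    rintro x hx rfl
    simp at hx
  have sq_one : ∀ {x : G}, orderOf x = 2 → x * x = 1 := fun {x} hx => by
    rw [← pow_two, ← hx, pow_orderOf_eq_one]
  have hs0 := sq_one h0
  have hs1 := sq_one h1
  have hs2 := sq_one h2
  have mem_closure_r₂ : ∀ x ∈ Subgroup.closure ({r₂} : Set G), x = 1 ∨ x = r₂ := by
    intro x hx
    obtain ⟨k, rfl⟩ := Subgroup.mem_closure_singleton.1 hx
    exact zpow_eq_one_or_self_of_mul_self hs2 k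
  have hgen : Subgroup.closure ({r₀, r₁} : Set G) = ⊤ := by
    rw [eq_top_iff, ← htop, Subgroup.closure_le]
    rintro x (rfl | rfl | rfl)
    · exact Subgroup.subset_closure (by simp)
    · exact Subgroup.subset_closure (by simp)
    · exact hr₂
  have hcomm : ∀ g, Commute g r₂ := by
    intro g
    have hn : (Subgroup.closure ({r₂} : Set G)).Normal := hcore ▸ Subgroup.normalCore_normal _
    obtain hg | hg := mem_closure_r₂ _ (hn.conj_mem r₂ (Subgroup.subset_closure rfl) g)
    · exact absurd (conj_eq_one_iff.1 hg) (ne_one h2)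
    · exact mul_inv_eq_iff_eq_mul.1 hg
  have hnot : r₀ * r₁ * r₀⁻¹ ∉ Subgroup.closure ({r₁, r₂} : Set G) := by
    intro hmem
    have hr1 : r₁ ∈ Subgroup.closure ({r₁, r₂} : Set G) := Subgroup.subset_closure (by simp)
    have hn : (Subgroup.closure ({r₁, r₂} : Set G)).Normal := by
      refine closure_normal_of_conj_mem hgen ?_ ?_
      · rintro g (rfl | rfl) <;> assumption
      · rintro g (rfl | rfl) x hx
        · have hle : Subgroup.closure ({r₁, r₂} : Set G) ≤
              (Subgroup.closure ({r₁, r₂} : Set G)).comap (MulAut.conj g).toMonoidHom := by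
            rw [Subgroup.closure_le]
            rintro y (rfl | rfl)
            · exact hmem
            · change g * y * g⁻¹ ∈ Subgroup.closure ({r₁, y} : Set G)
              rw [(hcomm g).eq, mul_inv_cancel_right]
              exact Subgroup.subset_closure (by simp)
          exact hle hx
        · exact mul_mem (mul_mem hr1 hx) (inv_mem hr1)
    rw [Subgroup.normalCore_eq_self] at hcore
    obtain hx | hx := mem_closure_r₂ r₁ (hcore ▸ hr1)
    · exact ne_one h1 hx
    · exact h12 hx
  have hrot : r₂ ∈ Subgroup.zpowers (r₀ * r₁) := by
    rw [← dihedralHom_range hs0 hs1] at hr₂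
    obtain ⟨i | i, hi⟩ := hr₂ <;> obtain ⟨k, rfl⟩ := ZMod.intCast_surjective i
    · exact ⟨k, by rw [← hi, dihedralHom_r]⟩
    · rw [dihedralHom_sr] at hi
      have hc : Commute r₀ (r₀ * r₁) := by
        have hr : r₀ = r₂ * ((r₀ * r₁) ^ k)⁻¹ := eq_mul_inv_of_mul_eq hi
        have := ((hcomm (r₀ * r₁)).symm).mul_left
          (((Commute.refl (r₀ * r₁)).zpow_left k).inv_left)
        rwa [← hr] at this
      obtain hk | hk := zpow_eq_one_or_self_of_mul_self
        (mul_mul_self_eq_one_of_commute hs0 hs1 hc) k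
      · exact absurd (by rw [← hi, hk, mul_one]) h02
      · exact absurd (by rw [← hi, hk, ← mul_assoc, hs0, one_mul]) h12
  obtain ⟨k, hkm, hk⟩ : ∃ k < orderOf (r₀ * r₁), (r₀ * r₁) ^ k = r₂ := by
    classical
    simpa using mem_zpowers_iff_mem_range_orderOf.1 hrot
  have hk0 : k ≠ 0 := by
    rintro rfl
    exact ne_one h2 (by rw [← hk, pow_zero])
  have hm : orderOf (r₀ * r₁) = 2 * k := by
    have hdvd : orderOf (r₀ * r₁) ∣ 2 * k := by
      rw [orderOf_dvd_iff_pow_eq_one, two_mul, pow_add, hk, hs2]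
    obtain ⟨c, hc⟩ := hdvd
    have hc2 : c < 2 := by
      by_contra! hge
      have := Nat.mul_le_mul_left (orderOf (r₀ * r₁)) hge
      omega
    interval_cases c <;> omega
  have hr0inv : r₀⁻¹ = r₀ := (eq_inv_of_mul_eq_one_left hs0).symm
  have hr1mem : r₁ ∈ Subgroup.closure ({r₁, r₂} : Set G) := Subgroup.subset_closure (by simp)
  have hr2mem : r₂ ∈ Subgroup.closure ({r₁, r₂} : Set G) := Subgroup.subset_closure (by simp)
  have hk3 : 3 ≤ k := by
    by_contra! hlt
    interval_cases k
    · exact hk0 rfl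
    · have hr0 : r₀ = r₂ * r₁ := by rw [← hk, pow_one, mul_assoc, hs1, mul_one]
      have hr0mem : r₀ ∈ Subgroup.closure ({r₁, r₂} : Set G) :=
        hr0 ▸ mul_mem hr2mem hr1mem
      exact hnot (mul_mem (mul_mem hr0mem hr1mem) (inv_mem hr0mem))
    · refine hnot ?_
      have hr : r₀ * r₁ * r₀⁻¹ = r₂ * r₁ := by
        rw [← hk, hr0inv, pow_two]
        simp only [mul_assoc, hs1, mul_one]
      exact hr ▸ mul_mem hr2mem hr1mem
  refine ⟨hgen, ⟨k, by omega⟩, by omega, by rw [hm, Nat.mul_div_cancel_left k two_pos, hk], ?_⟩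
  refine ⟨(MulEquiv.ofBijective (dihedralHom hs0 hs1)
    ⟨dihedralHom_injective hs0 hs1 (ne_one h0) (ne_one h1), ?_⟩).symm⟩
  rw [← MonoidHom.range_eq_top, dihedralHom_range, hgen]
end

section
/- Let n ≥ 3 be an integer and let G = C₂ × D_{2n}, where D_{2n} is the dihedral group of order 2n with rotation ρ of order n and reflection s, and let a be the generator of the C₂ factor. Set r₀ = (1, s), r₁ = (1, sρ), r₂ = (a, 1). Then (r₀, r₁, r₂) is a regular linear hypermap triple for G; moreover, the subgroups ⟨r₁,r₂⟩ and ⟨r₀,r₂⟩ each have index n in G, and ⟨r₀,r₁⟩ has index 2 in G. -/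
open Pointwise

/-- The subgroup of `C × D` generated by `(1, s)` and `(a, 1)`, where `a` generates `C`. -/
theorem Subgroup.closure_pair_one_left_one_right {C D : Type*} [Group C] [Group D] {a : C}
    (ha : Subgroup.zpowers a = ⊤) (s : D) :
    Subgroup.closure {((1 : C), s), (a, (1 : D))} =
      (⊤ : Subgroup C).prod (Subgroup.zpowers s) := by
  apply le_antisymm
  · rw [Subgroup.closure_le]
    rintro x (rfl | rfl)
    · exact ⟨Subgroup.mem_top _, Subgroup.mem_zpowers s⟩
    · exact ⟨Subgroup.mem_top _, Subgroup.one_mem _⟩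
  · rintro ⟨c, d⟩ ⟨-, k, hk⟩
    obtain ⟨l, hl⟩ : c ∈ Subgroup.zpowers a := ha ▸ Subgroup.mem_top c
    have h : (c, d) = (a, (1 : D)) ^ l * ((1 : C), s) ^ k := by
      ext
      · simpa using hl.symm
      · simpa using hk.symm
    rw [h]
    exact mul_mem (zpow_mem (Subgroup.subset_closure (by simp)) _)
      (zpow_mem (Subgroup.subset_closure (by simp)) _)

theorem Subgroup.bot_prod_eq_map_inr {C D : Type*} [Group C] [Group D] (K : Subgroup D) :
    (⊥ : Subgroup C).prod K = K.map (MonoidHom.inr C D) := by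
  ext ⟨c, d⟩
  simp [Subgroup.mem_prod, and_comm, eq_comm]

theorem Subgroup.prod_bot_eq_map_inl {C D : Type*} [Group C] [Group D] (H : Subgroup C) :
    H.prod (⊥ : Subgroup D) = H.map (MonoidHom.inl C D) := by
  ext ⟨c, d⟩
  simp [Subgroup.mem_prod, eq_comm]

/-- Two consecutive reflections generate the dihedral group. -/
theorem DihedralGroup.closure_sr_zero_sr_one (n : ℕ) :
    Subgroup.closure {DihedralGroup.sr (0 : ZMod n), DihedralGroup.sr 1} = ⊤ := by
  rw [eq_top_iff]
  have h0 : DihedralGroup.sr (0 : ZMod n) ∈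
      Subgroup.closure {DihedralGroup.sr (0 : ZMod n), DihedralGroup.sr 1} :=
    Subgroup.subset_closure (by simp)
  have h1 : DihedralGroup.sr (1 : ZMod n) ∈
      Subgroup.closure {DihedralGroup.sr (0 : ZMod n), DihedralGroup.sr 1} :=
    Subgroup.subset_closure (by simp)
  have hr (i : ZMod n) : DihedralGroup.r i ∈
      Subgroup.closure {DihedralGroup.sr (0 : ZMod n), DihedralGroup.sr 1} := by
    obtain ⟨k, rfl⟩ := ZMod.intCast_surjective i
    simpa using zpow_mem (mul_mem h0 h1) k
  rintro (i | i) -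
  · exact hr i
  · simpa using mul_mem h0 (hr i)

theorem DihedralGroup.mem_zpowers_sr {n : ℕ} {i : ZMod n} {x : DihedralGroup n} :
    x ∈ Subgroup.zpowers (DihedralGroup.sr i) ↔ x = 1 ∨ x = DihedralGroup.sr i := by
  constructor
  · rintro ⟨k, rfl⟩
    have hsq : DihedralGroup.sr i ^ (2 : ℤ) = 1 := by
      rw [zpow_ofNat, sq, DihedralGroup.sr_mul_self]
    rcases Int.even_or_odd' k with ⟨m, rfl | rfl⟩
    · left
      simp only [zpow_mul, hsq, one_zpow]
    · right
      simp only [zpow_add, zpow_mul, hsq, one_zpow, one_mul, zpow_one]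
  · rintro (rfl | rfl)
    · exact one_mem _
    · exact Subgroup.mem_zpowers _

theorem DihedralGroup.index_zpowers_sr {n : ℕ} [NeZero n] (i : ZMod n) :
    (Subgroup.zpowers (DihedralGroup.sr i)).index = n := by
  have h := (Subgroup.zpowers (DihedralGroup.sr i)).card_mul_index
  rw [Nat.card_zpowers, DihedralGroup.orderOf_sr, DihedralGroup.nat_card] at h
  lia

theorem zpowers_ofAdd_one_eq_top (n : ℕ) :
    Subgroup.zpowers (Multiplicative.ofAdd (1 : ZMod n)) = ⊤ := by
  rw [eq_top_iff]
  rintro x -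
  obtain ⟨k, hk⟩ := ZMod.intCast_surjective x.toAdd
  refine ⟨k, ?_⟩
  simp [← ofAdd_zsmul, hk]

theorem stmt_9 (n : ℕ) (hn : 3 ≤ n)
    (r₀ r₁ r₂ : Multiplicative (ZMod 2) × DihedralGroup n)
    (hr₀ : r₀ = (1, DihedralGroup.sr 0))
    (hr₁ : r₁ = (1, DihedralGroup.sr 0 * DihedralGroup.r 1))
    (hr₂ : r₂ = (Multiplicative.ofAdd (1 : ZMod 2), 1)) :
    IsRLHTriple r₀ r₁ r₂ ∧
    (Subgroup.closure {r₁, r₂}).index = n ∧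
    (Subgroup.closure {r₀, r₂}).index = n ∧
    (Subgroup.closure {r₀, r₁}).index = 2 := by
  have : NeZero n := ⟨by lia⟩
  have : Fact (1 < n) := ⟨by lia⟩
  have htwo : (2 : ZMod n) ≠ 0 := by
    intro h
    have := (ZMod.natCast_eq_zero_iff 2 n).1 (by exact_mod_cast h)
    exact absurd (Nat.le_of_dvd two_pos this) (by lia)
  have hneg : (-1 : ZMod n) ≠ 1 := by
    intro h
    apply htwo
    linear_combination -h
  rw [DihedralGroup.sr_mul_r, zero_add] at hr₁
  have hC := zpowers_ofAdd_one_eq_top 2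
  have h12 : Subgroup.closure {r₁, r₂} =
      (⊤ : Subgroup (Multiplicative (ZMod 2))).prod (Subgroup.zpowers (DihedralGroup.sr 1)) := by
    rw [hr₁, hr₂, Subgroup.closure_pair_one_left_one_right hC]
  have h02 : Subgroup.closure {r₀, r₂} =
      (⊤ : Subgroup (Multiplicative (ZMod 2))).prod (Subgroup.zpowers (DihedralGroup.sr 0)) := by
    rw [hr₀, hr₂, Subgroup.closure_pair_one_left_one_right hC]
  have h01 : Subgroup.closure {r₀, r₁} =
      (⊥ : Subgroup (Multiplicative (ZMod 2))).prod (⊤ : Subgroup (DihedralGroup n)) := by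
    rw [← DihedralGroup.closure_sr_zero_sr_one, Subgroup.bot_prod_eq_map_inr, MonoidHom.map_closure,
      Set.image_pair, hr₀, hr₁]
    rfl
  have h2 : Subgroup.closure {r₂} =
      (⊤ : Subgroup (Multiplicative (ZMod 2))).prod (⊥ : Subgroup (DihedralGroup n)) := by
    rw [← hC, Subgroup.prod_bot_eq_map_inl, MonoidHom.map_zpowers, Subgroup.zpowers_eq_closure, hr₂]
    rfl
  have ho : orderOf (Multiplicative.ofAdd (1 : ZMod 2)) = 2 := by
    rw [orderOf_ofAdd_eq_addOrderOf, ZMod.addOrderOf_one]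
  refine ⟨⟨?_, ?_, ?_, ?_, ?_, ?_, ?_, ?_, ?_⟩, ?_, ?_, ?_⟩
  · simp [hr₀, Prod.orderOf]
  · simp [hr₁, Prod.orderOf]
  · simp [hr₂, Prod.orderOf, ho]
  · simp [hr₀, hr₁]
  · simp [hr₀, hr₂, DihedralGroup.one_def, -DihedralGroup.r_zero]
  · simp [hr₁, hr₂, DihedralGroup.one_def, -DihedralGroup.r_zero]
  · rw [eq_top_iff]
    rintro ⟨c, d⟩ -
    rw [← one_mul d, ← mul_one c, ← Prod.mk_mul_mk]
    refine mul_mem (Subgroup.closure_mono (h := {r₂}) (by simp) ?_)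
      (Subgroup.closure_mono (h := {r₀, r₁}) (by grind) ?_)
    · simp [h2, Subgroup.mem_prod]
    · simp [h01, Subgroup.mem_prod]
  · rw [h12, h02, h2]
    ext ⟨c, d⟩
    simp only [Subgroup.mem_inf, Subgroup.mem_prod, DihedralGroup.mem_zpowers_sr,
      Subgroup.mem_top, Subgroup.mem_bot, true_and]
    constructor
    · rintro ⟨rfl | rfl, h⟩
      · rfl
      · simpa using h
    · rintro rfl
      simp
  · rw [h12, h02]
    ext ⟨c, d⟩
    simp only [Set.mem_inter_iff, Set.mem_mul, Set.mem_union, SetLike.mem_coe,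
      Subgroup.mem_prod, DihedralGroup.mem_zpowers_sr, Subgroup.mem_top, true_and]
    constructor
    · rintro ⟨⟨⟨a, x⟩, hx, ⟨b, y⟩, hy, hxy⟩, ⟨⟨a', x'⟩, hx', ⟨b', y'⟩, hy', hxy'⟩⟩
      obtain ⟨-, rfl⟩ := Prod.mk.inj hxy
      obtain ⟨-, h⟩ := Prod.mk.inj hxy'
      rcases hx with rfl | rfl <;> rcases hy with rfl | rfl <;>
        rcases hx' with rfl | rfl <;> rcases hy' with rfl | rfl <;>
        simp_all [DihedralGroup.one_def, -DihedralGroup.r_zero, eq_comm]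
    · rintro (h | h)
      · exact ⟨⟨(c, d), h, 1, by simp, by simp⟩, ⟨1, by simp, (c, d), h, by simp⟩⟩
      · exact ⟨⟨1, by simp, (c, d), h, by simp⟩, ⟨(c, d), h, 1, by simp, by simp⟩⟩
  · rw [h12, Subgroup.index_prod, DihedralGroup.index_zpowers_sr, Subgroup.index_top, one_mul]
  · rw [h02, Subgroup.index_prod, DihedralGroup.index_zpowers_sr, Subgroup.index_top, one_mul]
  · rw [h01, Subgroup.index_prod, Subgroup.index_top, mul_one, Subgroup.index_bot]
    simp
end

section
/- Let G be a group generated by three involutions r₀, r₁, r₂ with r₁ ≠ r₂, such that r₀ commutes with r₂, the subgroup H = ⟨r₁, r₂⟩ is a proper subgroup of G, and H ∩ r₀Hr₀ = ⟨r₂⟩. Then, with K = ⟨r₀, r₂⟩: (a) H ∩ K = ⟨r₂⟩, and (b) the subset H·K ∩ K·H of G equals H ∪ K; consequently (r₀, r₁, r₂) is a regular linear hypermap triple for G, and so is (r₁, r₀, r₂). -/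
open Pointwise

theorem Commute.of_mem_closure_singleton {G : Type*} [Group G] {a b c : G} (h : Commute a b)
    (hc : c ∈ Subgroup.closure ({b} : Set G)) : Commute a c := by
  obtain ⟨n, rfl⟩ := Subgroup.mem_closure_singleton.1 hc
  exact h.zpow_right n

/-- If `a` is an involution commuting with `b`, then `⟨a, b⟩ = ⟨b⟩ ∪ a⟨b⟩`. -/
theorem Subgroup.mem_or_mul_mem_of_mem_closure_pair {G : Type*} [Group G] {a b x : G}
    (ha : a * a = 1) (h : Commute a b) (hx : x ∈ Subgroup.closure ({a, b} : Set G)) :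
    x ∈ Subgroup.closure ({b} : Set G) ∨ a * x ∈ Subgroup.closure ({b} : Set G) := by
  have hinv : a⁻¹ = a := inv_eq_of_mul_eq_one_left ha
  have hcomm : ∀ {y : G}, y ∈ Subgroup.closure ({a, b} : Set G) → Commute a y := by
    intro y hy
    induction hy using Subgroup.closure_induction with
    | mem y hy =>
      rcases hy with rfl | rfl
      · exact Commute.refl _
      · exact h
    | one => exact Commute.one_right _
    | mul y z _ _ hy hz => exact hy.mul_right hz
    | inv y _ hy => exact hy.inv_right
  induction hx using Subgroup.closure_induction with
  | mem x hx =>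
    rcases hx with rfl | rfl
    · exact Or.inr (ha ▸ one_mem _)
    · exact Or.inl (Subgroup.mem_closure_singleton_self x)
  | one => exact Or.inl (one_mem _)
  | mul x y hx _ ihx ihy =>
    rcases ihx with ihx | ihx <;> rcases ihy with ihy | ihy
    · exact Or.inl (mul_mem ihx ihy)
    · refine Or.inr ?_
      rw [← mul_assoc, (hcomm hx).eq, mul_assoc]
      exact mul_mem ihx ihy
    · refine Or.inr ?_
      rw [← mul_assoc]
      exact mul_mem ihx ihy
    · refine Or.inl ?_
      have hxy : x * y = a * x * (a * y) := by
        rw [(hcomm hx).eq, mul_assoc, ← mul_assoc a a y, ha, one_mul]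
      rw [hxy]
      exact mul_mem ihx ihy
  | inv x hx ih =>
    rcases ih with ih | ih
    · exact Or.inl (inv_mem ih)
    · refine Or.inr ?_
      have hax : a * x⁻¹ = (a * x)⁻¹ := by rw [mul_inv_rev, hinv, (hcomm hx).inv_right.eq]
      rw [hax]
      exact inv_mem ih

theorem stmt_11 {G : Type*} [Group G] (r₀ r₁ r₂ : G)
    (h0 : orderOf r₀ = 2) (h1 : orderOf r₁ = 2) (h2 : orderOf r₂ = 2)
    (h12 : r₁ ≠ r₂)
    (hgen : Subgroup.closure ({r₀, r₁, r₂} : Set G) = ⊤)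
    (hcomm : Commute r₀ r₂)
    (hproper : Subgroup.closure ({r₁, r₂} : Set G) ≠ ⊤)
    (hconj : Subgroup.closure ({r₁, r₂} : Set G) ⊓
        (Subgroup.closure ({r₁, r₂} : Set G)).map (MulAut.conj r₀).toMonoidHom =
      Subgroup.closure ({r₂} : Set G)) :
    Subgroup.closure ({r₁, r₂} : Set G) ⊓ Subgroup.closure ({r₀, r₂} : Set G) =
      Subgroup.closure ({r₂} : Set G) ∧
    ((Subgroup.closure {r₁, r₂} : Set G) * (Subgroup.closure {r₀, r₂} : Set G)) ∩
        ((Subgroup.closure {r₀, r₂} : Set G) * (Subgroup.closure {r₁, r₂} : Set G)) =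
      (Subgroup.closure {r₁, r₂} : Set G) ∪ (Subgroup.closure {r₀, r₂} : Set G) ∧
    IsRLHTriple r₀ r₁ r₂ ∧ IsRLHTriple r₁ r₀ r₂ := by
  have hsq : r₀ * r₀ = 1 := by rw [← pow_two, ← h0, pow_orderOf_eq_one]
  have hH : Subgroup.closure ({r₂} : Set G) ≤ Subgroup.closure {r₁, r₂} :=
    Subgroup.closure_mono (by simp)
  have hK : Subgroup.closure ({r₂} : Set G) ≤ Subgroup.closure {r₀, r₂} :=
    Subgroup.closure_mono (by simp)
  have hr₀K : r₀ ∈ Subgroup.closure ({r₀, r₂} : Set G) :=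
    Subgroup.subset_closure (by simp)
  have hr₀H : r₀ ∉ Subgroup.closure ({r₁, r₂} : Set G) := by
    refine fun hr₀ => hproper (top_unique (hgen ▸ (Subgroup.closure_le _).2 ?_))
    exact Set.insert_subset hr₀ Subgroup.subset_closure
  have hKcases {x : G} (hx : x ∈ Subgroup.closure ({r₀, r₂} : Set G)) :
      x ∈ Subgroup.closure ({r₂} : Set G) ∨ r₀ * x ∈ Subgroup.closure ({r₂} : Set G) :=
    Subgroup.mem_or_mul_mem_of_mem_closure_pair hsq hcomm hx
  have hinf : Subgroup.closure ({r₁, r₂} : Set G) ⊓ Subgroup.closure ({r₀, r₂} : Set G) =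
      Subgroup.closure ({r₂} : Set G) := by
    refine le_antisymm ?_ (le_inf hH hK)
    rintro x ⟨hxH, hxK⟩
    refine (hKcases hxK).resolve_right fun hx => hr₀H ?_
    exact (Subgroup.mul_mem_cancel_right _ hxH).1 (hH hx)
  have hprod : ((Subgroup.closure {r₁, r₂} : Set G) * (Subgroup.closure {r₀, r₂} : Set G)) ∩
      ((Subgroup.closure {r₀, r₂} : Set G) * (Subgroup.closure {r₁, r₂} : Set G)) =
      (Subgroup.closure {r₁, r₂} : Set G) ∪ (Subgroup.closure {r₀, r₂} : Set G) := by
    refine Set.Subset.antisymm ?_ (Set.union_subset ?_ ?_)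
    · rintro x ⟨⟨h, hh, k, hk, rfl⟩, k', hk', h', hh', heq⟩
      simp only [SetLike.mem_coe] at hh hk hh' hk'
      change k' * h' = h * k at heq
      change h * k ∈ _
      rcases hKcases hk with hk₂ | hk₂
      · exact Or.inl (mul_mem hh (hH hk₂))
      rcases hKcases hk' with hk₂' | hk₂'
      · exact Or.inl (heq ▸ mul_mem (hH hk₂') hh')
      · refine Or.inr (mul_mem ?_ hk)
        have hmem : h * (r₀ * k) ∈ Subgroup.closure ({r₂} : Set G) := by
          rw [← hconj]
          refine ⟨mul_mem hh (hH hk₂), r₀ * k' * h', mul_mem (hH hk₂') hh', ?_⟩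
          have hkr : r₀ * k = k * r₀ := by
            have hc := (hcomm.of_mem_closure_singleton hk₂).eq
            rw [mul_assoc] at hc
            exact mul_left_cancel hc
          change r₀ * (r₀ * k' * h') * r₀⁻¹ = h * (r₀ * k)
          rw [inv_eq_of_mul_eq_one_left hsq, hkr, ← mul_assoc, ← mul_assoc, ← mul_assoc, hsq,
            one_mul, heq, mul_assoc]
        exact (Subgroup.mul_mem_cancel_right _ (hK hk₂)).1 (hK hmem)
    · exact fun x hx => ⟨⟨x, hx, 1, one_mem _, mul_one x⟩, 1, one_mem _, x, hx, one_mul x⟩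
    · exact fun x hx => ⟨⟨1, one_mem _, x, hx, one_mul x⟩, x, hx, 1, one_mem _, mul_one x⟩
  have h01 : r₀ ≠ r₁ := fun h => hr₀H (Subgroup.subset_closure (by simp [h]))
  have h02 : r₀ ≠ r₂ := fun h => hr₀H (Subgroup.subset_closure (by simp [h]))
  refine ⟨hinf, hprod, ⟨h0, h1, h2, h01, h02, h12, hgen, hinf, hprod⟩,
    h1, h0, h2, h01.symm, h12, h02, ?_, ?_, ?_⟩
  · rw [Set.insert_comm, hgen]
  · rw [inf_comm, hinf]
  · rw [Set.inter_comm, Set.union_comm, hprod]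
end

section
/- Let G = A₅ × C₂ be the direct product of the alternating group on {1,2,3,4,5} with a cyclic group of order 2. The automorphism group Aut(G) acts componentwise on the set of regular linear hypermap triples (r₀, r₁, r₂) for G, and this action has exactly 19 orbits. -/
open Pointwise

/-- The setoid on regular linear hypermap triples for `G` given by the componentwise
action of `Aut(G)`: two triples are related iff some automorphism of `G` maps one
to the other. -/
def RLHTripleSetoid (G : Type*) [Group G] :
    Setoid {t : G × G × G // IsRLHTriple t.1 t.2.1 t.2.2} where
  r s t := ∃ τ : G ≃* G, τ s.val.1 = t.val.1 ∧ τ s.val.2.1 = t.val.2.1 ∧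
    τ s.val.2.2 = t.val.2.2
  iseqv := by
    constructor
    · intro s; exact ⟨MulEquiv.refl G, rfl, rfl, rfl⟩
    · rintro s t ⟨τ, ha, hb, hc⟩
      exact ⟨τ.symm, by simp [← ha], by simp [← hb], by simp [← hc]⟩
    · rintro s t u ⟨τ, ha, hb, hc⟩ ⟨τ', ha', hb', hc'⟩
      exact ⟨τ.trans τ', by simp [ha, ha'], by simp [hb, hb'], by simp [hc, hc']⟩

section GroupLemmas

variable {G : Type*} [Group G]

/-- For subgroups `A`, `B` containing `C`, the two intersection conditions are equivalent to a
single condition on products. -/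
theorem inf_eq_and_mul_inter_mul_eq_iff {A B C : Subgroup G} (hA : C ≤ A) (hB : C ≤ B) :
    (A ⊓ B = C ∧ ((A : Set G) * B) ∩ ((B : Set G) * A) = (A : Set G) ∪ B) ↔
      ∀ a ∈ A, ∀ b ∈ B, a * b ∈ ((B : Set G) * A) → a ∈ C ∨ b ∈ C := by
  constructor
  · rintro ⟨hinf, hmul⟩ a ha b hb hab
    have h : a * b ∈ (A : Set G) ∪ B := hmul ▸ ⟨Set.mul_mem_mul ha hb, hab⟩
    rcases h with h | h
    · exact .inr (hinf ▸ ⟨(A.mul_mem_cancel_left ha).1 h, hb⟩)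
    · exact .inl (hinf ▸ ⟨ha, (B.mul_mem_cancel_right hb).1 h⟩)
  · intro h
    refine ⟨le_antisymm ?_ (le_inf hA hB), Set.Subset.antisymm ?_ ?_⟩
    · rintro g ⟨hgA, hgB⟩
      exact (h g hgA g hgB (Set.mul_mem_mul hgB hgA)).elim id id
    · rintro _ ⟨⟨a, ha, b, hb, rfl⟩, hab⟩
      rcases h a ha b hb hab with hc | hc
      · exact .inr (B.mul_mem (hB hc) hb)
      · exact .inl (A.mul_mem ha (hA hc))
    · rintro g (hg | hg)
      · exact ⟨⟨g, hg, 1, B.one_mem, mul_one g⟩, ⟨1, B.one_mem, g, hg, one_mul g⟩⟩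
      · exact ⟨⟨1, A.one_mem, g, hg, one_mul g⟩, ⟨g, hg, 1, A.one_mem, mul_one g⟩⟩

theorem mem_closure_singleton_of_sq {c g : G} (hc : c * c = 1) :
    g ∈ Subgroup.closure {c} ↔ g = 1 ∨ g = c := by
  constructor
  · intro h
    induction h using Subgroup.closure_induction with
    | mem x hx => exact .inr hx
    | one => exact .inl rfl
    | mul x y _ _ hx hy => rcases hx with rfl | rfl <;> rcases hy with rfl | rfl <;> simp [hc]
    | inv x _ hx =>
      rcases hx with rfl | rfl
      · simp
      · exact .inr (inv_eq_of_mul_eq_one_left hc)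
  · rintro (rfl | rfl)
    · exact one_mem _
    · exact Subgroup.mem_closure_singleton_self _

theorem mul_zpow_rotation {x c : G} (hx : x * x = 1) (hc : c * c = 1) (i : ℤ) :
    c * (x * c) ^ i = (x * c) ^ (-i) * c := by
  have hxi : x⁻¹ = x := inv_eq_of_mul_eq_one_left hx
  have hci : c⁻¹ = c := inv_eq_of_mul_eq_one_left hc
  have h : SemiconjBy c (x * c) (x * c)⁻¹ := by
    simp [SemiconjBy, hxi, hci, mul_assoc]
  rw [zpow_neg, ← inv_zpow]
  exact (h.zpow_right i).eq

theorem exists_zpow_of_mem_closure_pair {x c g : G} (hx : x * x = 1) (hc : c * c = 1)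
    (hg : g ∈ Subgroup.closure {x, c}) : ∃ i : ℤ, g = (x * c) ^ i ∨ g = (x * c) ^ i * c := by
  have hxi : x⁻¹ = x := inv_eq_of_mul_eq_one_left hx
  have hci : c⁻¹ = c := inv_eq_of_mul_eq_one_left hc
  have hcm : ∀ y, (∃ i : ℤ, y = (x * c) ^ i ∨ y = (x * c) ^ i * c) →
      ∃ i : ℤ, c * y = (x * c) ^ i ∨ c * y = (x * c) ^ i * c := by
    rintro y ⟨i, rfl | rfl⟩
    · exact ⟨-i, .inr (mul_zpow_rotation hx hc i)⟩
    · refine ⟨-i, .inl ?_⟩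
      rw [← mul_assoc, mul_zpow_rotation hx hc, mul_assoc, hc, mul_one]
  have hxm : ∀ y, (∃ i : ℤ, y = (x * c) ^ i ∨ y = (x * c) ^ i * c) →
      ∃ i : ℤ, x * y = (x * c) ^ i ∨ x * y = (x * c) ^ i * c := by
    intro y hy
    have hxy : x * y = (x * c) * (c * y) := by
      rw [mul_assoc, ← mul_assoc c, hc, one_mul]
    obtain ⟨i, hi⟩ := hcm y hy
    refine ⟨1 + i, ?_⟩
    rw [hxy, zpow_add, zpow_one]
    rcases hi with hi | hi <;> rw [hi]
    · exact .inl rfl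
    · exact .inr (mul_assoc _ _ _).symm
  induction hg using Subgroup.closure_induction_left with
  | one => exact ⟨0, .inl (by simp)⟩
  | mul_left z hz y _ hy =>
    rcases hz with rfl | rfl
    exacts [hxm y hy, hcm y hy]
  | inv_mul_cancel z hz y _ hy =>
    rcases hz with rfl | rfl
    · rw [hxi]; exact hxm y hy
    · rw [hci]; exact hcm y hy

theorem exists_pow_lt_of_pow_eq_one {p : G} {n : ℕ} (hn : 0 < n) (hp : p ^ n = 1) (i : ℤ) :
    ∃ j < n, p ^ i = p ^ j := by
  have hn' : (n : ℤ) ≠ 0 := by omega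
  have h0 := Int.emod_nonneg i hn'
  have h1 := Int.emod_lt_of_pos i (by omega : (0 : ℤ) < n)
  refine ⟨(i % n).toNat, by omega, ?_⟩
  rw [← zpow_natCast, Int.toNat_of_nonneg h0]
  conv_lhs => rw [← Int.emod_add_mul_ediv i n]
  rw [zpow_add, zpow_mul, zpow_natCast, hp, one_zpow, mul_one]

theorem exists_pow_mul_of_mem_closure_pair {x c g : G} {n : ℕ} (hn : 0 < n) (hx : x * x = 1)
    (hc : c * c = 1) (hp : (x * c) ^ n = 1) (hg : g ∈ Subgroup.closure {x, c}) :
    ∃ j < n, ∃ d, (d = 1 ∨ d = c) ∧ g = (x * c) ^ j * d := by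
  obtain ⟨i, hi⟩ := exists_zpow_of_mem_closure_pair hx hc hg
  obtain ⟨j, hj, hij⟩ := exists_pow_lt_of_pow_eq_one hn hp i
  rw [hij] at hi
  rcases hi with hi | hi
  · exact ⟨j, hj, 1, .inl rfl, by rw [hi, mul_one]⟩
  · exact ⟨j, hj, c, .inr rfl, hi⟩

theorem exists_mul_pow_of_mem_closure_pair {x c g : G} {n : ℕ} (hn : 0 < n) (hx : x * x = 1)
    (hc : c * c = 1) (hp : (x * c) ^ n = 1) (hg : g ∈ Subgroup.closure {x, c}) :
    ∃ j < n, ∃ d, (d = 1 ∨ d = c) ∧ g = d * (x * c) ^ j := by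
  obtain ⟨i, hi⟩ := exists_zpow_of_mem_closure_pair hx hc hg
  rcases hi with hi | hi
  · obtain ⟨j, hj, hij⟩ := exists_pow_lt_of_pow_eq_one hn hp i
    exact ⟨j, hj, 1, .inl rfl, by rw [hi, hij, one_mul]⟩
  · obtain ⟨j, hj, hij⟩ := exists_pow_lt_of_pow_eq_one hn hp (-i)
    refine ⟨j, hj, c, .inr rfl, ?_⟩
    rw [hi, ← hij, mul_zpow_rotation hx hc, neg_neg]

/-- The linearity condition on the rotations `p` of `⟨r₁, r₂⟩` and `q` of `⟨r₀, r₂⟩`, tested on the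
first `n` powers of `p` and the first `m` powers of `q`. -/
def RotationLinear (p q c : G) (n m : ℕ) : Prop :=
  ∀ i < n, ∀ j < m, p ^ i = 1 ∨ p ^ i = c ∨ q ^ j = 1 ∨ q ^ j = c ∨
    ∀ k < m, ∀ l < n, p ^ i * q ^ j ≠ q ^ k * p ^ l ∧ p ^ i * q ^ j ≠ q ^ k * c * p ^ l

theorem rotationLinear_of_closure {x y c : G} (hc : c * c = 1) (n m : ℕ)
    (h : ∀ a ∈ Subgroup.closure {x, c}, ∀ b ∈ Subgroup.closure {y, c},
      a * b ∈ ((Subgroup.closure {y, c} : Set G) * (Subgroup.closure {x, c} : Set G)) →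
        a ∈ Subgroup.closure {c} ∨ b ∈ Subgroup.closure {c}) :
    RotationLinear (x * c) (y * c) c n m := by
  have hcx : c ∈ Subgroup.closure {x, c} := Subgroup.subset_closure (by simp)
  have hcy : c ∈ Subgroup.closure {y, c} := Subgroup.subset_closure (by simp)
  have hx (i : ℕ) : (x * c) ^ i ∈ Subgroup.closure {x, c} :=
    pow_mem (mul_mem (Subgroup.subset_closure (by simp)) hcx) i
  have hy (i : ℕ) : (y * c) ^ i ∈ Subgroup.closure {y, c} :=
    pow_mem (mul_mem (Subgroup.subset_closure (by simp)) hcy) i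
  intro i _ j _
  by_contra! hcon
  obtain ⟨h1, h2, h3, h4, k, _, l, _, hkl⟩ := hcon
  have hmem : (x * c) ^ i * (y * c) ^ j ∈
      ((Subgroup.closure {y, c} : Set G) * (Subgroup.closure {x, c} : Set G)) := by
    by_cases he : (x * c) ^ i * (y * c) ^ j = (y * c) ^ k * (x * c) ^ l
    · exact ⟨_, hy k, _, hx l, he.symm⟩
    · exact ⟨_, mul_mem (hy k) hcy, _, hx l, (hkl he).symm⟩
  have := h _ (hx i) _ (hy j) hmem
  simp only [mem_closure_singleton_of_sq hc] at this
  tauto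

theorem closure_of_rotationLinear {x y c : G} (hx : x * x = 1) (hy : y * y = 1) (hc : c * c = 1)
    {n m : ℕ} (hn : 0 < n) (hm : 0 < m) (hp : (x * c) ^ n = 1) (hq : (y * c) ^ m = 1)
    (h : RotationLinear (x * c) (y * c) c n m) :
    ∀ a ∈ Subgroup.closure {x, c}, ∀ b ∈ Subgroup.closure {y, c},
      a * b ∈ ((Subgroup.closure {y, c} : Set G) * (Subgroup.closure {x, c} : Set G)) →
        a ∈ Subgroup.closure {c} ∨ b ∈ Subgroup.closure {c} := by
  rintro a ha b hb ⟨b', hb', a', ha', hab⟩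
  have hcx : c ∈ Subgroup.closure {x, c} := Subgroup.subset_closure (by simp)
  have hcy : c ∈ Subgroup.closure {y, c} := Subgroup.subset_closure (by simp)
  have hcc (d : G) (hd : d = 1 ∨ d = c) : d * d = 1 := by rcases hd with rfl | rfl <;> simp [hc]
  obtain ⟨i, hi, d, hd, rfl⟩ := exists_mul_pow_of_mem_closure_pair hn hx hc hp ha
  obtain ⟨j, hj, e, he, rfl⟩ := exists_pow_mul_of_mem_closure_pair hm hy hc hq hb
  have hdy : d * b' ∈ Subgroup.closure {y, c} := by
    rcases hd with rfl | rfl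
    exacts [mul_mem (one_mem _) hb', mul_mem hcy hb']
  have hex : a' * e ∈ Subgroup.closure {x, c} := by
    rcases he with rfl | rfl
    exacts [mul_mem ha' (one_mem _), mul_mem ha' hcx]
  obtain ⟨k, hk, f, hf, hfe⟩ := exists_pow_mul_of_mem_closure_pair hm hy hc hq hdy
  obtain ⟨l, hl, g, hg, hge⟩ := exists_mul_pow_of_mem_closure_pair hn hx hc hp hex
  have key : (x * c) ^ i * (y * c) ^ j = (y * c) ^ k * (f * g) * (x * c) ^ l := by
    calc (x * c) ^ i * (y * c) ^ j
        = (d * d) * (x * c) ^ i * ((y * c) ^ j * (e * e)) := by rw [hcc d hd, hcc e he]; simp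
      _ = d * (d * (x * c) ^ i * ((y * c) ^ j * e)) * e := by simp only [mul_assoc]
      _ = (d * b') * (a' * e) := by rw [← hab]; simp only [mul_assoc]
      _ = _ := by rw [hfe, hge]; simp only [mul_assoc]
  simp only [mem_closure_singleton_of_sq hc]
  rcases h i hi j hj with h1 | h1 | h1 | h1 | h1
  · left; rw [h1, mul_one]; exact hd
  · left; rw [h1]; rcases hd with rfl | rfl <;> simp [hc]
  · right; rw [h1, one_mul]; exact he
  · right; rw [h1]; rcases he with rfl | rfl <;> simp [hc]
  · obtain ⟨h2, h3⟩ := h1 k hk l hl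
    rcases hf with rfl | rfl <;> rcases hg with rfl | rfl <;> simp_all

/-- A noncommutative simple group is not generated by two elements squaring to `1`. -/
theorem closure_pair_ne_top [IsSimpleGroup G] (hG : ∃ a b : G, a * b ≠ b * a) {x y : G}
    (hx : x * x = 1) (hy : y * y = 1) : Subgroup.closure {x, y} ≠ ⊤ := by
  intro htop
  have hmem (g : G) := exists_zpow_of_mem_closure_pair hx hy (htop ▸ Subgroup.mem_top g)
  have hnormal : (Subgroup.zpowers (x * y)).Normal := by
    refine ⟨?_⟩
    rintro _ ⟨k, rfl⟩ g
    obtain ⟨i, rfl | rfl⟩ := hmem g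
    · exact ⟨k, by simp [← zpow_add, ← zpow_neg]⟩
    · refine ⟨-k, ?_⟩
      have hyi : y⁻¹ = y := inv_eq_of_mul_eq_one_left hy
      have := mul_zpow_rotation hx hy k
      simp only [mul_inv_rev, hyi]
      rw [mul_assoc _ y, this, mul_assoc, mul_assoc _ y, ← mul_assoc y y, hy, one_mul,
        ← zpow_neg, ← zpow_add, ← zpow_add]
      congr 1
      ring
  obtain ⟨a, b, hab⟩ := hG
  rcases hnormal.eq_bot_or_eq_top with h | h
  · rw [Subgroup.zpowers_eq_bot] at h
    apply hab
    obtain ⟨i, ha⟩ := hmem a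
    obtain ⟨j, hb⟩ := hmem b
    simp only [h, one_zpow, one_mul] at ha hb
    rcases ha with rfl | rfl <;> rcases hb with rfl | rfl <;> simp
  · apply hab
    obtain ⟨i, rfl⟩ := Subgroup.mem_zpowers_iff.1 (h ▸ Subgroup.mem_top a)
    obtain ⟨j, rfl⟩ := Subgroup.mem_zpowers_iff.1 (h ▸ Subgroup.mem_top b)
    exact (Commute.refl (x * y)).zpow_zpow i j

/-- A subgroup containing more than half of the elements is everything. -/
theorem eq_top_of_card_lt_two_mul [Finite G] (H : Subgroup G)
    (h : Nat.card G < 2 * Nat.card H) : H = ⊤ := by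
  have hpos : 0 < Nat.card G := Nat.card_pos
  rw [← Subgroup.index_eq_one]
  have h1 := H.card_mul_index
  have h2 : H.index ≠ 0 := Subgroup.index_ne_zero_of_finite
  by_contra h3
  have : 2 ≤ H.index := by omega
  nlinarith

end GroupLemmas

section Transport

variable {G : Type*} [Group G]

theorem map_closure_pair (τ : G ≃* G) (x y : G) :
    Subgroup.closure {τ x, τ y} = (Subgroup.closure {x, y}).map τ.toMonoidHom := by
  rw [MonoidHom.map_closure, Set.image_pair]; rfl

theorem isRLHTriple_iff {x y c : G} : IsRLHTriple x y c ↔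
    orderOf x = 2 ∧ orderOf y = 2 ∧ orderOf c = 2 ∧ x ≠ y ∧ x ≠ c ∧ y ≠ c ∧
      Subgroup.closure {x, y, c} = (⊤ : Subgroup G) ∧
      ∀ a ∈ Subgroup.closure {y, c}, ∀ b ∈ Subgroup.closure {x, c},
        a * b ∈ ((Subgroup.closure {x, c} : Set G) * (Subgroup.closure {y, c} : Set G)) →
          a ∈ Subgroup.closure {c} ∨ b ∈ Subgroup.closure {c} := by
  rw [IsRLHTriple, inf_eq_and_mul_inter_mul_eq_iff (Subgroup.closure_mono (by simp))
    (Subgroup.closure_mono (by simp))]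

theorem IsRLHTriple.map {x y c : G} (τ : G ≃* G) (h : IsRLHTriple x y c) :
    IsRLHTriple (τ x) (τ y) (τ c) := by
  obtain ⟨hx, hy, hc, hxy, hxc, hyc, htop, hinf, hmul⟩ := h
  have hcl : Subgroup.closure {τ c} = (Subgroup.closure {c}).map τ.toMonoidHom := by
    rw [MonoidHom.map_closure, Set.image_singleton]; rfl
  refine ⟨by simpa, by simpa, by simpa, by simpa, by simpa, by simpa, ?_, ?_, ?_⟩
  · have : ({τ x, τ y, τ c} : Set G) = τ.toMonoidHom '' {x, y, c} := by
      simp [Set.image_insert_eq]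
    rw [this, ← MonoidHom.map_closure, htop, ← MonoidHom.range_eq_map]
    exact MonoidHom.range_eq_top.2 τ.surjective
  · rw [map_closure_pair, map_closure_pair, hcl, ← hinf, Subgroup.map_inf _ _ _ τ.injective]
  · rw [map_closure_pair, map_closure_pair]
    simp only [Subgroup.coe_map]
    have hτ : Function.Injective τ.toMonoidHom := τ.injective
    rw [← Set.image_mul, ← Set.image_mul, ← Set.image_inter hτ, hmul, Set.image_union]

end Transport
/-- The base-8 digit of `a` at position `k`. -/
def digit (a k : ℕ) : ℕ := a / 8 ^ k % 8

/-- Multiplication of codes: composition of the digit strings `p ↦ σ p`, and addition modulo 2 in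
the position of weight `8 ^ 5`. -/
def codeMul (a b : ℕ) : ℕ :=
  digit a (digit b 0) + 8 * (digit a (digit b 1) + 8 * (digit a (digit b 2) +
    8 * (digit a (digit b 3) + 8 * (digit a (digit b 4) + 8 * ((a / 32768 + b / 32768) % 2)))))

/-- The code of the identity. -/
def codeOne : ℕ := 18056

/-- The codes of the powers `p ^ i` with `i < n`. -/
def codePowers (p n : ℕ) : List ℕ := List.iterate (codeMul p) codeOne n

/-- The least `m + 1 ≥ 1` with `p ^ m * x = 1`, searched up to the given bound. -/
def orderFrom (p x : ℕ) : ℕ → ℕ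
  | 0 => 1
  | n + 1 => if Nat.beq x codeOne then 1 else orderFrom p (codeMul p x) n + 1

/-- The order of an element, read off from its code. -/
def codeOrder (p : ℕ) : ℕ := orderFrom p p 12

/-- Linearity test on the codes `p` of `r₁ * r₂`, `q` of `r₀ * r₂` and `c` of `r₂`. -/
def codeLinear (p q c n m : ℕ) : Bool :=
  (codePowers p n).all fun x => (codePowers q m).all fun y =>
    Nat.beq x codeOne || Nat.beq x c || Nat.beq y codeOne || Nat.beq y c ||
      (codePowers q m).all fun u => (codePowers p n).all fun v =>
        !Nat.beq (codeMul x y) (codeMul u v) && !Nat.beq (codeMul x y) (codeMul (codeMul u c) v)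

/-- Whether `z` lies in the dihedral group generated by `x` and `y`. -/
def codeDihedral (x y z : ℕ) : Bool :=
  (codePowers (codeMul x y) (codeOrder (codeMul x y))).any fun u =>
    Nat.beq z u || Nat.beq z (codeMul u y)

/-- The codes of the involutions of `A₅`. -/
def involutionCodes : List ℕ :=
  [17601, 16922, 16467, 14416, 8984, 5344, 14346, 8459, 1228, 14465, 4259, 668, 9985, 5666, 1620]

/-- The codes of the centralizer of `(0 1)(2 3)` in `S₅`. -/
def centralizerCodes : List ℕ :=
  [18056, 17608, 18049, 17601, 16922, 16474, 16915, 16467]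

/-- The codes of orbit representatives. -/
def representatives : List (ℕ × ℕ × ℕ) :=
  [(16922, 47184, 50369), (49690, 14416, 17601), (49690, 47184, 50369), (16922, 41752, 50369),
   (49690, 8984, 17601), (49690, 41752, 50369), (16922, 38112, 50369), (49690, 5344, 17601),
   (49690, 38112, 50369), (14416, 49690, 17601), (47184, 16922, 50369), (47184, 49690, 50369),
   (14416, 49235, 17601), (47184, 16467, 50369), (47184, 49235, 50369), (5344, 49690, 17601),
   (38112, 16922, 50369), (38112, 49690, 50369), (38112, 47233, 50369)]

/-- Whether some element centralizing `(0 1)(2 3)` conjugates `(x, y, z)` to a representative. -/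
def codeEquivalent (x y z : ℕ) : Bool :=
  centralizerCodes.any fun d => representatives.any fun t =>
    Nat.beq z t.2.2 && Nat.beq (codeMul d x) (codeMul t.1 d) &&
      Nat.beq (codeMul d y) (codeMul t.2.1 d) && Nat.beq (codeMul d z) (codeMul z d)

/-- The exhaustive check for triples whose third component lies over `(0 1)(2 3)`, up to
conjugation by its centralizer. -/
def coveringCheck : Bool :=
  [17601, 16922, 14416, 5344].all fun s => involutionCodes.all fun t =>
    Nat.beq s 17601 || codeDihedral s 17601 t ||
      [0, 32768].all fun e => [0, 32768].all fun f => [0, 32768].all fun g =>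
        (Nat.beq e 0 && Nat.beq f 0 && Nat.beq g 0) ||
          !codeLinear (codeMul (t + f) (17601 + g)) (codeMul (s + e) (17601 + g)) (17601 + g)
            (codeOrder (codeMul (t + f) (17601 + g))) (codeOrder (codeMul (s + e) (17601 + g))) ||
          codeEquivalent (s + e) (t + f) (17601 + g)

/-- Breadth-first search under left multiplication by `gs`. -/
def reach (gs : List ℕ) : ℕ → List ℕ → List ℕ → List ℕ
  | 0, _, seen => seen
  | _ + 1, [], seen => seen
  | n + 1, x :: queue, seen =>
    let new := (gs.map fun g => codeMul g x).filter fun y => !seen.any (Nat.beq y)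
    reach gs n (queue ++ new) (new ++ seen)

/-- A Boolean version of `List.Nodup`. -/
def pairwiseNe : List ℕ → Bool
  | [] => true
  | x :: l => l.all (fun y => !Nat.beq x y) && pairwiseNe l

/-- Whether the breadth-first search from the identity finds more than 60 distinct elements. -/
def codeGenerates (gs : List ℕ) : Bool :=
  Nat.ble 61 (reach gs 50 [codeOne] [codeOne]).length &&
    pairwiseNe (reach gs 50 [codeOne] [codeOne])

/-- Whether `x` is the code of an involution. -/
def codeInvolution (x : ℕ) : Bool :=
  Nat.beq (codeMul x x) codeOne && !Nat.beq x codeOne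

/-- A sufficient test for being a regular linear hypermap triple. -/
def codeValid (x y c : ℕ) : Bool :=
  codeInvolution x && codeInvolution y && codeInvolution c && pairwiseNe [x, y, c] &&
    codeGenerates [x, y, c] &&
    Nat.beq ((codeMul (codeMul y c))^[codeOrder (codeMul y c)] codeOne) codeOne &&
    Nat.beq ((codeMul (codeMul x c))^[codeOrder (codeMul x c)] codeOne) codeOne &&
    codeLinear (codeMul y c) (codeMul x c) c (codeOrder (codeMul y c)) (codeOrder (codeMul x c))

/-- Words whose triviality separates the orbit representatives. -/
def separatingWords : List (List (Fin 3)) :=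
  [(2, [2, 1]), (3, [2, 0]), (5, [1, 0]), (5, [2, 1, 0]), (5, [2, 0, 1, 0]), (3, [2, 1, 0]),
    (6, [1, 0]), (3, [1, 0])].map fun w => (List.replicate w.1 w.2).flatten

/-- The code of a word in three elements. -/
def codeWord (t : Fin 3 → ℕ) (w : List (Fin 3)) : ℕ :=
  w.foldr (fun i => codeMul (t i)) codeOne

/-- The set of separating words that are trivial, as a binary number. -/
def signature (t : Fin 3 → ℕ) : ℕ :=
  separatingWords.foldr (fun w n => 2 * n + if Nat.beq (codeWord t w) codeOne then 1 else 0) 0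

theorem coveringCheck_eq_true : coveringCheck = true := by decide +kernel

theorem codeValid_of_mem_representatives :
    ∀ t ∈ representatives, codeValid t.1 t.2.1 t.2.2 = true := by decide +kernel

theorem pairwiseNe_signature :
    pairwiseNe (representatives.map fun t => signature ![t.1, t.2.1, t.2.2]) = true := by
  decide +kernel

open Equiv Equiv.Perm

/-- The alternating group of degree 5 times a group of order 2. -/
abbrev A5C2 : Type := alternatingGroup (Fin 5) × Multiplicative (ZMod 2)

/-- The code of an element of `S₅ × C₂`. -/
def permCode (σ : Perm (Fin 5)) (e : Multiplicative (ZMod 2)) : ℕ :=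
  σ 0 + 8 * (σ 1 + 8 * (σ 2 + 8 * (σ 3 + 8 * (σ 4 + 8 * (Multiplicative.toAdd e).val))))

/-- The code of an element of `A₅ × C₂`. -/
def code (g : A5C2) : ℕ := permCode g.1 g.2

theorem exists_conj_base : ∀ σ : Perm (Fin 5), sign σ = 1 → σ * σ = 1 → σ ≠ 1 →
    ∃ τ : Perm (Fin 5), τ * σ * τ⁻¹ = swap 0 1 * swap 2 3 := by
  decide +kernel

theorem permCode_mem_involutionCodes : ∀ σ : Perm (Fin 5), sign σ = 1 → σ * σ = 1 → σ ≠ 1 →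
    permCode σ 1 ∈ involutionCodes := by
  decide +kernel

theorem exists_conj_mem : ∀ σ : Perm (Fin 5), sign σ = 1 → σ * σ = 1 → σ ≠ 1 →
    ∃ τ : Perm (Fin 5), τ * (swap 0 1 * swap 2 3) * τ⁻¹ = swap 0 1 * swap 2 3 ∧
      permCode (τ * σ * τ⁻¹) 1 ∈ [17601, 16922, 14416, 5344] := by
  decide +kernel

theorem exists_permCode_eq : ∀ d ∈ centralizerCodes, ∃ σ : Perm (Fin 5), permCode σ 1 = d := by
  decide +kernel

/-- The pairs of transpositions defining the double transpositions of degree 5. -/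
def doubleTransposition : Fin 15 → (Fin 5 × Fin 5) × (Fin 5 × Fin 5) :=
  ![((0, 1), (2, 3)), ((0, 2), (1, 3)), ((0, 3), (1, 2)), ((1, 2), (3, 4)), ((1, 3), (2, 4)),
    ((1, 4), (2, 3)), ((0, 2), (3, 4)), ((0, 3), (2, 4)), ((0, 4), (2, 3)), ((0, 1), (3, 4)),
    ((0, 3), (1, 4)), ((0, 4), (1, 3)), ((0, 1), (2, 4)), ((0, 2), (1, 4)), ((0, 4), (1, 2))]

theorem doubleTransposition_ne : ∀ k, (doubleTransposition k).1.1 ≠ (doubleTransposition k).1.2 ∧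
    (doubleTransposition k).2.1 ≠ (doubleTransposition k).2.2 := by
  decide

/-- The element of `A₅ × C₂` over the `k`-th double transposition. -/
def involution (k : Fin 15) (e : ZMod 2) : A5C2 :=
  (⟨swap (doubleTransposition k).1.1 (doubleTransposition k).1.2 *
      swap (doubleTransposition k).2.1 (doubleTransposition k).2.2, by
    rw [mem_alternatingGroup, Perm.sign_mul, sign_swap (doubleTransposition_ne k).1,
      sign_swap (doubleTransposition_ne k).2]
    rfl⟩, Multiplicative.ofAdd e)

/-- The orbit representatives. -/
def representative (i : Fin 19) : Fin 3 → A5C2 :=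
  let d : Fin 15 × Fin 15 × ZMod 2 × ZMod 2 × ZMod 2 :=
    ![(1, 3, 0, 1, 1), (1, 3, 1, 0, 0), (1, 3, 1, 1, 1), (1, 4, 0, 1, 1), (1, 4, 1, 0, 0),
      (1, 4, 1, 1, 1), (1, 5, 0, 1, 1), (1, 5, 1, 0, 0), (1, 5, 1, 1, 1), (3, 1, 0, 1, 0),
      (3, 1, 1, 0, 1), (3, 1, 1, 1, 1), (3, 2, 0, 1, 0), (3, 2, 1, 0, 1), (3, 2, 1, 1, 1),
      (5, 1, 0, 1, 0), (5, 1, 1, 0, 1), (5, 1, 1, 1, 1), (5, 9, 1, 1, 1)] i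
  ![involution d.1 d.2.2.1, involution d.2.1 d.2.2.2.1, involution 0 d.2.2.2.2]

theorem representatives_eq_ofFn : representatives = List.ofFn fun i =>
    (code (representative i 0), code (representative i 1), code (representative i 2)) := by
  decide +kernel

section Code

theorem digit_permCode (σ : Perm (Fin 5)) (e : Multiplicative (ZMod 2)) (k : Fin 5) :
    digit (permCode σ e) k = σ k := by
  have h0 := (σ 0).isLt
  have h1 := (σ 1).isLt
  have h2 := (σ 2).isLt
  have h3 := (σ 3).isLt
  have h4 := (σ 4).isLt
  fin_cases k <;> simp [digit, permCode] <;> omega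

theorem permCode_div (σ : Perm (Fin 5)) (e : Multiplicative (ZMod 2)) :
    permCode σ e / 32768 = (Multiplicative.toAdd e).val := by
  have h0 := (σ 0).isLt
  have h1 := (σ 1).isLt
  have h2 := (σ 2).isLt
  have h3 := (σ 3).isLt
  have h4 := (σ 4).isLt
  simp only [permCode]
  omega

theorem permCode_mul (σ τ : Perm (Fin 5)) (e f : Multiplicative (ZMod 2)) :
    permCode (σ * τ) (e * f) = codeMul (permCode σ e) (permCode τ f) := by
  have h (k : Fin 5) : digit (permCode σ e) (digit (permCode τ f) k) = (σ * τ) k := by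
    rw [digit_permCode, digit_permCode]; rfl
  have h0 := h 0
  have h1 := h 1
  have h2 := h 2
  have h3 := h 3
  have h4 := h 4
  simp only [Fin.val_zero, Fin.val_one, Fin.val_two,
    show ((3 : Fin 5) : ℕ) = 3 from rfl, show ((4 : Fin 5) : ℕ) = 4 from rfl] at h0 h1 h2 h3 h4
  rw [codeMul, h0, h1, h2, h3, h4, permCode_div, permCode_div, permCode, toAdd_mul, ZMod.val_add]

theorem permCode_injective {σ τ : Perm (Fin 5)} {e f : Multiplicative (ZMod 2)}
    (h : permCode σ e = permCode τ f) : σ = τ ∧ e = f := by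
  constructor
  · ext k
    rw [← digit_permCode σ e, ← digit_permCode τ f, h]
  · apply Multiplicative.toAdd.injective
    apply ZMod.val_injective 2
    rw [← permCode_div σ e, ← permCode_div τ f, h]

theorem code_injective : Function.Injective code := fun _ _ h =>
  Prod.ext (Subtype.ext (permCode_injective h).1) (permCode_injective h).2

theorem code_mul (g h : A5C2) : code (g * h) = codeMul (code g) (code h) := permCode_mul _ _ _ _

theorem code_one : code 1 = codeOne := by decide +kernel

theorem code_eq_codeOne {g : A5C2} : code g = codeOne ↔ g = 1 := by
  rw [← code_one, code_injective.eq_iff]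

theorem iterate_codeMul (p g : A5C2) (n : ℕ) : (codeMul (code p))^[n] (code g) =
    code (p ^ n * g) := by
  induction n with
  | zero => simp
  | succ n ih => rw [Function.iterate_succ_apply', ih, ← code_mul, pow_succ', mul_assoc]

theorem mem_codePowers {p : A5C2} {n a : ℕ} :
    a ∈ codePowers (code p) n ↔ ∃ i < n, a = code (p ^ i) := by
  simp only [codePowers, List.mem_iterate, ← code_one, iterate_codeMul, mul_one]

theorem orderFrom_pos (p x n : ℕ) : 0 < orderFrom p x n := by
  cases n with
  | zero => simp [orderFrom]
  | succ n => rw [orderFrom]; split <;> omega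

theorem codeOrder_pos (p : ℕ) : 0 < codeOrder p := orderFrom_pos _ _ _

theorem beq_eq_false_iff {m n : ℕ} : Nat.beq m n = false ↔ m ≠ n := by
  rw [← Bool.not_eq_true, Nat.beq_eq]

theorem codeLinear_iff {p q c : A5C2} {n m : ℕ} :
    codeLinear (code p) (code q) (code c) n m = true ↔ RotationLinear p q c n m := by
  simp only [codeLinear, List.all_eq_true, mem_codePowers, RotationLinear]
  constructor
  · intro h i hi j hj
    have := h _ ⟨i, hi, rfl⟩ _ ⟨j, hj, rfl⟩
    simp only [Bool.or_eq_true, Nat.beq_eq, List.all_eq_true, mem_codePowers, code_eq_codeOne,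
      code_injective.eq_iff] at this
    rcases this with (((h | h) | h) | h) | h
    · exact .inl h
    · exact .inr (.inl h)
    · exact .inr (.inr (.inl h))
    · exact .inr (.inr (.inr (.inl h)))
    · refine .inr (.inr (.inr (.inr ?_)))
      intro k hk l hl
      have := h _ ⟨k, hk, rfl⟩ _ ⟨l, hl, rfl⟩
      simpa only [← code_mul, Bool.and_eq_true, Bool.not_eq_true', beq_eq_false_iff,
        code_injective.ne_iff] using this
  · rintro h _ ⟨i, hi, rfl⟩ _ ⟨j, hj, rfl⟩
    simp only [Bool.or_eq_true, Nat.beq_eq, List.all_eq_true, mem_codePowers, code_eq_codeOne,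
      code_injective.eq_iff]
    rcases h i hi j hj with h | h | h | h | h
    · exact .inl (.inl (.inl (.inl h)))
    · exact .inl (.inl (.inl (.inr h)))
    · exact .inl (.inl (.inr h))
    · exact .inl (.inr h)
    · right
      rintro _ ⟨k, hk, rfl⟩ _ ⟨l, hl, rfl⟩
      simpa only [← code_mul, Bool.and_eq_true, Bool.not_eq_true', beq_eq_false_iff,
        code_injective.ne_iff] using h k hk l hl

theorem mem_closure_of_codeDihedral {x y z : A5C2}
    (h : codeDihedral (code x) (code y) (code z) = true) : z ∈ Subgroup.closure {x, y} := by
  have hx : x ∈ Subgroup.closure {x, y} := Subgroup.subset_closure (by simp)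
  have hy : y ∈ Subgroup.closure {x, y} := Subgroup.subset_closure (by simp)
  rw [codeDihedral, ← code_mul, List.any_eq_true] at h
  obtain ⟨u, hu, h⟩ := h
  obtain ⟨i, _, rfl⟩ := mem_codePowers.1 hu
  rw [← code_mul, Bool.or_eq_true, Nat.beq_eq, Nat.beq_eq, code_injective.eq_iff,
    code_injective.eq_iff] at h
  rcases h with rfl | rfl
  · exact pow_mem (mul_mem hx hy) i
  · exact mul_mem (pow_mem (mul_mem hx hy) i) hy

theorem nodup_of_pairwiseNe {l : List ℕ} (h : pairwiseNe l = true) : l.Nodup := by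
  induction l with
  | nil => exact List.nodup_nil
  | cons x l ih =>
    rw [pairwiseNe, Bool.and_eq_true, List.all_eq_true] at h
    refine List.nodup_cons.2 ⟨fun hx => ?_, ih h.2⟩
    have := h.1 x hx
    simp at this

theorem reach_subset {H : Subgroup A5C2} {gs : List ℕ} (hgs : ∀ a ∈ gs, a ∈ code '' H) (n : ℕ) :
    ∀ queue seen : List ℕ, (∀ a ∈ queue, a ∈ code '' H) → (∀ a ∈ seen, a ∈ code '' H) →
      ∀ a ∈ reach gs n queue seen, a ∈ code '' H := by
  induction n with
  | zero => intro _ _ _ hs; exact hs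
  | succ n ih =>
    intro queue seen hq hs
    cases queue with
    | nil => exact hs
    | cons x queue =>
      have hnew : ∀ a ∈ (gs.map fun g => codeMul g x).filter fun y => !seen.any (Nat.beq y),
          a ∈ code '' H := by
        intro a ha
        obtain ⟨b, hb, rfl⟩ := List.mem_map.1 (List.mem_filter.1 ha).1
        obtain ⟨g, hg, rfl⟩ := hgs b hb
        obtain ⟨y, hy, rfl⟩ := hq x (by simp)
        exact ⟨g * y, H.mul_mem hg hy, code_mul g y⟩
      apply ih
      · intro a ha
        rcases List.mem_append.1 ha with ha | ha
        exacts [hq a (List.mem_cons_of_mem _ ha), hnew a ha]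
      · intro a ha
        rcases List.mem_append.1 ha with ha | ha
        exacts [hnew a ha, hs a ha]

theorem card_A5C2 : Nat.card A5C2 = 120 := by
  rw [Nat.card_prod, nat_card_alternatingGroup]
  simp [Nat.factorial]

theorem eq_top_of_codeGenerates {H : Subgroup A5C2} {gs : List ℕ}
    (hgs : ∀ a ∈ gs, a ∈ code '' H) (h : codeGenerates gs = true) : H = ⊤ := by
  rw [codeGenerates, Bool.and_eq_true, Nat.ble_eq] at h
  have hone : ∀ a ∈ [codeOne], a ∈ code '' H := by
    intro a ha
    rw [List.mem_singleton.1 ha]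
    exact ⟨1, H.one_mem, code_one⟩
  apply eq_top_of_card_lt_two_mul
  have hcard : 61 ≤ Nat.card H := by
    rw [← List.toFinset_card_of_nodup (nodup_of_pairwiseNe h.2), ← Set.ncard_coe_finset] at h
    refine h.1.trans ?_
    change _ ≤ Nat.card (H : Set A5C2)
    rw [← Nat.card_image_of_injective code_injective]
    refine Set.ncard_le_ncard (fun a ha => ?_) (Set.toFinite _)
    exact reach_subset hgs 50 _ _ hone hone a (by simpa using ha)
  rw [card_A5C2]
  omega

theorem orderOf_of_codeInvolution {x : A5C2} (h : codeInvolution (code x) = true) :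
    orderOf x = 2 := by
  simp only [codeInvolution, ← code_mul, Bool.and_eq_true, Nat.beq_eq, Bool.not_eq_true',
    beq_eq_false_iff, ne_eq, code_eq_codeOne] at h
  exact orderOf_eq_prime (by rw [sq, h.1]) h.2

theorem mul_self_of_orderOf {G : Type*} [Group G] {x : G} (h : orderOf x = 2) : x * x = 1 := by
  rw [← sq, ← h, pow_orderOf_eq_one]

theorem isRLHTriple_of_codeValid {x y c : A5C2} (h : codeValid (code x) (code y) (code c) = true) :
    IsRLHTriple x y c := by
  simp only [codeValid, Bool.and_eq_true, Nat.beq_eq, ← code_mul] at h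
  obtain ⟨⟨⟨⟨⟨⟨⟨hx, hy⟩, hc⟩, hne⟩, hgen⟩, hp⟩, hq⟩, hlin⟩ := h
  have hne := nodup_of_pairwiseNe hne
  simp only [List.nodup_cons, List.mem_cons, List.not_mem_nil, code_injective.eq_iff] at hne
  have hx := orderOf_of_codeInvolution hx
  have hy := orderOf_of_codeInvolution hy
  have hc := orderOf_of_codeInvolution hc
  rw [← code_one, iterate_codeMul, mul_one, code_injective.eq_iff] at hp hq
  obtain ⟨hxy, hxc, hyc⟩ : x ≠ y ∧ x ≠ c ∧ y ≠ c := by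
    clear * - hne
    tauto
  refine isRLHTriple_iff.2 ⟨hx, hy, hc, hxy, hxc, hyc, ?_,
    closure_of_rotationLinear (mul_self_of_orderOf hy) (mul_self_of_orderOf hx)
      (mul_self_of_orderOf hc) (codeOrder_pos _) (codeOrder_pos _) hp hq
      (codeLinear_iff.1 hlin)⟩
  refine eq_top_of_codeGenerates (fun a ha => ?_) hgen
  simp only [List.mem_cons, List.not_mem_nil, or_false] at ha
  rcases ha with rfl | rfl | rfl <;>
    exact Set.mem_image_of_mem _ (Subgroup.subset_closure (by simp))

theorem code_word (t : Fin 3 → A5C2) (w : List (Fin 3)) :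
    codeWord (fun i => code (t i)) w = code (w.map t).prod := by
  induction w with
  | nil => exact code_one.symm
  | cons i w ih => rw [codeWord, List.foldr_cons, List.map_cons, List.prod_cons, code_mul, ← ih]; rfl

theorem signature_map (τ : A5C2 ≃* A5C2) (t : Fin 3 → A5C2) :
    signature (fun i => code (τ (t i))) = signature fun i => code (t i) := by
  have h (w : List (Fin 3)) : Nat.beq (codeWord (fun i => code (τ (t i))) w) codeOne =
      Nat.beq (codeWord (fun i => code (t i)) w) codeOne := by
    have : (w.map fun i => τ (t i)) = (w.map t).map τ := by simp
    rw [Bool.eq_iff_iff, Nat.beq_eq, Nat.beq_eq, code_word, code_word, code_eq_codeOne,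
      code_eq_codeOne, this, ← map_list_prod, EmbeddingLike.map_eq_one_iff]
  simp only [signature, h]

end Code

section Representatives

theorem code_representative_mem (i : Fin 19) : (code (representative i 0),
    code (representative i 1), code (representative i 2)) ∈ representatives := by
  rw [representatives_eq_ofFn, List.mem_ofFn]
  exact ⟨i, rfl⟩

theorem isRLHTriple_representative (i : Fin 19) :
    IsRLHTriple (representative i 0) (representative i 1) (representative i 2) := by
  have h := codeValid_of_mem_representatives _ (code_representative_mem i)
  exact isRLHTriple_of_codeValid h

theorem signature_representative_injective :
    Function.Injective fun i => signature fun j => code (representative i j) := by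
  have h := nodup_of_pairwiseNe pairwiseNe_signature
  rw [representatives_eq_ofFn, List.map_ofFn, List.nodup_ofFn] at h
  have heq (i : Fin 19) : ![code (representative i 0), code (representative i 1),
      code (representative i 2)] = fun j => code (representative i j) := by
    ext j
    fin_cases j <;> rfl
  simpa only [Function.comp_def, heq] using h

end Representatives

section Covering

/-- The automorphism of `A₅ × C₂` induced by conjugation in `S₅`. -/
def conjAut (σ : Perm (Fin 5)) : A5C2 ≃* A5C2 :=
  MulEquiv.prodCongr (MulAut.conjNormal σ) (MulEquiv.refl _)

theorem conjAut_fst (σ : Perm (Fin 5)) (g : A5C2) :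
    ((conjAut σ g).1 : Perm (Fin 5)) = σ * g.1 * σ⁻¹ :=
  MulAut.conjNormal_apply σ g.1

theorem conjAut_eq {σ : Perm (Fin 5)} {g h : A5C2}
    (heq : codeMul (permCode σ 1) (code g) = codeMul (code h) (permCode σ 1)) :
    conjAut σ g = h := by
  rw [code, code, ← permCode_mul, ← permCode_mul] at heq
  obtain ⟨h1, h2⟩ := permCode_injective heq
  refine Prod.ext (Subtype.ext ?_) ?_
  · rw [conjAut_fst, h1, mul_inv_cancel_right]
  · rw [one_mul, mul_one] at h2
    exact h2

theorem closure_fst_eq_top {x y c : A5C2} (h : Subgroup.closure {x, y, c} = ⊤) :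
    Subgroup.closure {x.1, y.1, c.1} = ⊤ := by
  have := congrArg (Subgroup.map (MonoidHom.fst _ _)) h
  rw [MonoidHom.map_closure, ← MonoidHom.range_eq_map,
    MonoidHom.range_eq_top.2 Prod.fst_surjective] at this
  simpa [Set.image_insert_eq] using this

theorem notMem_closure_fst {x y z : A5C2} (hx : x * x = 1) (hy : y * y = 1)
    (h : Subgroup.closure {x, y, z} = ⊤) : z.1 ∉ Subgroup.closure {x.1, y.1} := by
  intro hz
  have : IsSimpleGroup (alternatingGroup (Fin 5)) := alternatingGroup.isSimpleGroup (by simp)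
  have hnc : ∃ a b : alternatingGroup (Fin 5), a * b ≠ b * a :=
    ⟨(involution 0 0).1, (involution 3 0).1, by decide⟩
  apply closure_pair_ne_top hnc (congrArg Prod.fst hx) (congrArg Prod.fst hy)
  rw [eq_top_iff, ← closure_fst_eq_top h, Subgroup.closure_le]
  rintro g (rfl | rfl | rfl)
  · exact Subgroup.subset_closure (by simp)
  · exact Subgroup.subset_closure (by simp)
  · exact hz

theorem exists_snd_ne_one {x y c : A5C2} (h : Subgroup.closure {x, y, c} = ⊤) :
    ¬ (x.2 = 1 ∧ y.2 = 1 ∧ c.2 = 1) := by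
  rintro ⟨hx, hy, hc⟩
  have : Subgroup.closure {x, y, c} ≤ (MonoidHom.snd (alternatingGroup (Fin 5)) _).ker := by
    rw [Subgroup.closure_le]
    rintro g (rfl | rfl | rfl) <;> assumption
  rw [h] at this
  have h1 := this (Subgroup.mem_top ((1, Multiplicative.ofAdd 1) : A5C2))
  rw [MonoidHom.mem_ker] at h1
  revert h1
  decide

theorem code_eq_add (g : A5C2) : ∃ e ∈ [0, 32768], code g = permCode g.1 1 + e ∧
    (e = 0 ↔ g.2 = 1) := by
  obtain ⟨g, e⟩ := g
  obtain ⟨e, rfl⟩ := Multiplicative.ofAdd.surjective e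
  fin_cases e
  · exact ⟨0, by simp, rfl, fun _ => rfl, fun _ => rfl⟩
  · refine ⟨32768, by simp, ?_, fun h => absurd h (by decide),
      fun h => absurd h (show ¬Multiplicative.ofAdd (1 : ZMod 2) = 1 by decide)⟩
    have h0 : (Multiplicative.toAdd (1 : Multiplicative (ZMod 2))).val = 0 := rfl
    have h1 : (Multiplicative.toAdd (Multiplicative.ofAdd (1 : ZMod 2))).val = 1 := rfl
    simp only [code, permCode, h0]
    erw [h1]
    omega

/-- Each element of a regular linear hypermap triple lies over an involution of `A₅`. -/
theorem fst_involution {x y c : A5C2} (h : IsRLHTriple x y c) {z : A5C2}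
    (hz : z = x ∨ z = y ∨ z = c) :
    sign (z.1 : Perm (Fin 5)) = 1 ∧ (z.1 : Perm (Fin 5)) * z.1 = 1 ∧ (z.1 : Perm (Fin 5)) ≠ 1 := by
  obtain ⟨hx, hy, hc, -, -, -, htop, -⟩ := h
  have hx := mul_self_of_orderOf hx
  have hy := mul_self_of_orderOf hy
  have hc := mul_self_of_orderOf hc
  refine ⟨z.1.2, ?_, fun h1 => ?_⟩
  · have : z * z = 1 := by rcases hz with rfl | rfl | rfl <;> assumption
    exact congrArg (fun g : A5C2 => (g.1 : Perm (Fin 5))) this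
  · have h1 : z.1 = 1 := Subtype.ext h1
    rcases hz with rfl | rfl | rfl
    · have hset : ({y, c, z} : Set A5C2) = {z, y, c} := by
        rw [Set.pair_comm, Set.insert_comm]
      exact notMem_closure_fst hy hc (hset ▸ htop) (h1 ▸ one_mem _)
    · have hset : ({x, c, z} : Set A5C2) = {x, z, c} := by rw [Set.pair_comm]
      exact notMem_closure_fst hx hc (hset ▸ htop) (h1 ▸ one_mem _)
    · exact notMem_closure_fst hx hy htop (h1 ▸ one_mem _)

theorem exists_conjAut_of_codeEquivalent {x y c : A5C2}
    (h : codeEquivalent (code x) (code y) (code c) = true) :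
    ∃ σ i, conjAut σ x = representative i 0 ∧ conjAut σ y = representative i 1 ∧
      conjAut σ c = representative i 2 := by
  simp only [codeEquivalent, List.any_eq_true, Bool.and_eq_true, Nat.beq_eq] at h
  obtain ⟨d, hd, t, ht, ⟨⟨hc, hx⟩, hy⟩, hcd⟩ := h
  obtain ⟨σ, rfl⟩ := exists_permCode_eq d hd
  rw [representatives_eq_ofFn, List.mem_ofFn] at ht
  obtain ⟨i, rfl⟩ := ht
  exact ⟨σ, i, conjAut_eq hx, conjAut_eq hy, conjAut_eq (hc ▸ hcd)⟩

theorem exists_conjAut_of_normalized {x y c : A5C2} (h : IsRLHTriple x y c)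
    (hc : (c.1 : Perm (Fin 5)) = swap 0 1 * swap 2 3)
    (hx : permCode x.1 1 ∈ [17601, 16922, 14416, 5344]) :
    ∃ σ i, conjAut σ x = representative i 0 ∧ conjAut σ y = representative i 1 ∧
      conjAut σ c = representative i 2 := by
  have hy' := fst_involution h (z := y) (by simp)
  have hy := permCode_mem_involutionCodes _ hy'.1 hy'.2.1 hy'.2.2
  have hcc : permCode c.1 1 = 17601 := by rw [hc]; decide +kernel
  obtain ⟨hx2, hy2, hc2, -, -, -, htop, hlin⟩ := isRLHTriple_iff.1 h
  have hx2 := mul_self_of_orderOf hx2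
  have hy2 := mul_self_of_orderOf hy2
  have hc2 := mul_self_of_orderOf hc2
  obtain ⟨e, he, hxe, he1⟩ := code_eq_add x
  obtain ⟨f, hf, hyf, hf1⟩ := code_eq_add y
  obtain ⟨g, hg, hcg, hg1⟩ := code_eq_add c
  have key := coveringCheck_eq_true
  simp only [coveringCheck, List.all_eq_true, Bool.or_eq_true, Bool.and_eq_true, Nat.beq_eq,
    Bool.not_eq_true'] at key
  rcases key _ hx _ hy with (hxc | hdih) | key
  · have hxc : x.1 = c.1 := Subtype.ext (permCode_injective (hxc.trans hcc.symm)).1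
    exact absurd (hxc ▸ Subgroup.subset_closure (by simp)) (notMem_closure_fst hx2 hy2 htop)
  · rw [← hcc] at hdih
    have hmem := mem_closure_of_codeDihedral (x := (x.1, 1)) (y := (c.1, 1)) (z := (y.1, 1)) hdih
    have hset : ({x, c, y} : Set A5C2) = {x, y, c} := by rw [Set.pair_comm]
    refine absurd ?_ (notMem_closure_fst hx2 hc2 (hset ▸ htop))
    have := Subgroup.mem_map_of_mem
      (MonoidHom.fst (alternatingGroup (Fin 5)) (Multiplicative (ZMod 2))) hmem
    rwa [MonoidHom.map_closure, Set.image_pair] at this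
  · have key := key e he f hf g hg
    rw [← hcc, ← hxe, ← hyf, ← hcg, ← code_mul, ← code_mul, he1, hf1, hg1] at key
    rcases key with (key | key) | key
    · exact absurd ⟨key.1.1, key.1.2, key.2⟩ (exists_snd_ne_one htop)
    · have hlin := codeLinear_iff.2 (rotationLinear_of_closure hc2 (codeOrder (code (y * c)))
        (codeOrder (code (x * c))) hlin)
      exact absurd (hlin.symm.trans key) (by decide)
    · exact exists_conjAut_of_codeEquivalent key

theorem exists_mulEquiv_representative {x y c : A5C2} (h : IsRLHTriple x y c) :
    ∃ (τ : A5C2 ≃* A5C2) (i : Fin 19), τ x = representative i 0 ∧ τ y = representative i 1 ∧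
      τ c = representative i 2 := by
  have hc := fst_involution h (z := c) (by simp)
  obtain ⟨σ, hσ⟩ := exists_conj_base _ hc.1 hc.2.1 hc.2.2
  rw [← conjAut_fst] at hσ
  have h' := h.map (conjAut σ)
  have hx := fst_involution h' (z := conjAut σ x) (by simp)
  obtain ⟨ρ, hρ, hρx⟩ := exists_conj_mem _ hx.1 hx.2.1 hx.2.2
  rw [← conjAut_fst] at hρx
  obtain ⟨π, i, hi⟩ := exists_conjAut_of_normalized (h'.map (conjAut ρ))
    (by rw [conjAut_fst, hσ, hρ]) hρx
  exact ⟨((conjAut σ).trans (conjAut ρ)).trans (conjAut π), i, hi⟩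

end Covering

theorem stmt_13 :
    Nat.card (Quotient
      (RLHTripleSetoid (alternatingGroup (Fin 5) × Multiplicative (ZMod 2)))) = 19 := by
  let f (i : Fin 19) : Quotient (RLHTripleSetoid A5C2) :=
    Quotient.mk _ ⟨(representative i 0, representative i 1, representative i 2),
      isRLHTriple_representative i⟩
  have hf : Function.Bijective f := by
    constructor
    · intro i j hij
      obtain ⟨τ, h0, h1, h2⟩ : ∃ τ : A5C2 ≃* A5C2, τ (representative i 0) = representative j 0 ∧
          τ (representative i 1) = representative j 1 ∧
          τ (representative i 2) = representative j 2 := Quotient.exact hij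
      apply signature_representative_injective
      have h : ∀ k, τ (representative i k) = representative j k := by
        intro k
        fin_cases k
        exacts [h0, h1, h2]
      simp only [← h, signature_map]
    · intro q
      induction q using Quotient.inductionOn with
      | _ t =>
        obtain ⟨τ, i, h0, h1, h2⟩ := exists_mulEquiv_representative t.2
        refine ⟨i, Eq.symm (Quotient.sound (s := RLHTripleSetoid A5C2) ?_)⟩
        exact ⟨τ, h0, h1, h2⟩
  rw [← Nat.card_eq_of_bijective f hf, Nat.card_fin]
end

section
/- Let G = A₅ × C₂ be the direct product of the alternating group on {1,2,3,4,5} with a cyclic group of order 2, and consider the action of Aut(G) on the set of regular linear hypermap triples (r₀, r₁, r₂) for G. Exactly 7 of the orbits of this action consist of triples for which ⟨r₀r₂, r₁r₂⟩ is a proper subgroup of G (the orientable regular linear hypermaps), and exactly 12 orbits consist of triples with ⟨r₀r₂, r₁r₂⟩ = G (the non-orientable ones). -/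
open Pointwise

namespace A5TimesC2

/-- The symmetric group on five points times a cyclic group of order two. -/
abbrev S5C2 : Type := Equiv.Perm (Fin 5) × Multiplicative (ZMod 2)

/-- The direct product of the alternating group on five points and a cyclic group of order two. -/
abbrev A5C2 : Type := alternatingGroup (Fin 5) × Multiplicative (ZMod 2)

/-- The inclusion of `A₅ × C₂` in `S₅ × C₂`. -/
def incl : A5C2 →* S5C2 := (alternatingGroup (Fin 5)).subtype.prodMap (MonoidHom.id _)

/-- An element of `S₅ × C₂` written as a number, with the images of the points as base-five
digits. -/
def code (g : S5C2) : ℕ :=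
  g.1 0 + 5 * g.1 1 + 25 * g.1 2 + 125 * g.1 3 + 625 * g.1 4 + 3125 * (Multiplicative.toAdd g.2).val

/-- The multiplication of codes. -/
def mulc (x y : ℕ) : ℕ :=
  x / 5 ^ (y % 5) % 5 + 5 * (x / 5 ^ (y / 5 % 5) % 5) + 25 * (x / 5 ^ (y / 25 % 5) % 5) +
    125 * (x / 5 ^ (y / 125 % 5) % 5) + 625 * (x / 5 ^ (y / 625 % 5) % 5) +
    3125 * ((x / 3125 + y / 3125) % 2)

theorem code_div_pow_mod (g : S5C2) (i : Fin 5) : code g / 5 ^ (i : ℕ) % 5 = g.1 i := by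
  unfold code
  fin_cases i <;> simp <;> omega

theorem code_div (g : S5C2) : code g / 3125 = (Multiplicative.toAdd g.2).val := by
  unfold code
  omega

theorem code_injective : Function.Injective code := by
  intro g h e
  refine Prod.ext (Equiv.ext fun i => Fin.ext ?_) ?_
  · rw [← code_div_pow_mod, e, code_div_pow_mod]
  · have := congrArg (· / 3125) e
    simp only [code_div] at this
    exact Multiplicative.toAdd.injective (ZMod.val_injective 2 this)

theorem code_mul (g h : S5C2) : code (g * h) = mulc (code g) (code h) := by
  have digit (i : Fin 5) : code g / 5 ^ (code h / 5 ^ (i : ℕ) % 5) % 5 = (g * h).1 i := by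
    rw [code_div_pow_mod, code_div_pow_mod]; rfl
  have h0 := digit 0
  have h1 := digit 1
  have h2 := digit 2
  have h3 := digit 3
  have h4 := digit 4
  norm_num at h0 h1 h2 h3 h4
  have hs : (Multiplicative.toAdd (g * h).2).val = (code g / 3125 + code h / 3125) % 2 := by
    rw [code_div, code_div]; exact ZMod.val_add _ _
  rw [mulc, h0, h1, h2, h3, h4, ← hs]
  rfl

/-- The code of the identity. -/
def onec : ℕ := code 1

/-- The code of an element of `A₅ × C₂`. -/
def altCode (g : A5C2) : ℕ := code (incl g)

theorem altCode_injective : Function.Injective altCode :=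
  code_injective.comp (Prod.map_injective.2 ⟨Subtype.val_injective, Function.injective_id⟩)

theorem altCode_one : altCode 1 = onec := by
  rw [altCode, map_one, onec]

theorem altCode_mul (g h : A5C2) : altCode (g * h) = mulc (altCode g) (altCode h) := by
  rw [altCode, map_mul, code_mul, altCode, altCode]

/-- The set of entries of a list of codes as a bit mask. -/
def mask (L : List ℕ) : ℕ := L.foldr (fun n m => 2 ^ n ||| m) 0

theorem testBit_mask (L : List ℕ) (n : ℕ) : (mask L).testBit n = true ↔ n ∈ L := by
  induction L with
  | nil => simp [mask]
  | cons k L ih =>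
    rw [mask, List.foldr_cons, ← mask, Nat.testBit_or, Bool.or_eq_true, ih, Nat.testBit_two_pow,
      decide_eq_true_iff, List.mem_cons, eq_comm]

/-- Collect products of the codes in `gs`, starting from a list `todo` of codes to be extended and
a list `L` of codes already found, the latter also given as a bit mask `m`. -/
def grow (gs : List ℕ) : ℕ → List ℕ → List ℕ → ℕ → List ℕ
  | 0, _, L, _ => L
  | _ + 1, [], L, _ => L
  | fuel + 1, n :: todo, L, m =>
    let new := (gs.map (mulc n)).filter fun k => !m.testBit k
    grow gs fuel (new ++ todo) (new ++ L) (mask new ||| m)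

theorem forall_mem_grow {p : ℕ → Prop} {gs : List ℕ} (hp : ∀ n, p n → ∀ g ∈ gs, p (mulc n g))
    (fuel : ℕ) (todo L : List ℕ) (m : ℕ) (ht : ∀ n ∈ todo, p n) (hL : ∀ n ∈ L, p n) :
    ∀ n ∈ grow gs fuel todo L m, p n := by
  induction fuel generalizing todo L m with
  | zero => exact hL
  | succ fuel ih =>
    cases todo with
    | nil => exact hL
    | cons n todo =>
      rw [List.forall_mem_cons] at ht
      have hnew : ∀ k ∈ (gs.map (mulc n)).filter (fun k => !m.testBit k), p k := by
        intro k hk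
        obtain ⟨g, hg, rfl⟩ := List.mem_map.1 (List.mem_filter.1 hk).1
        exact hp n ht.1 g hg
      exact ih _ _ _ (List.forall_mem_append.2 ⟨hnew, ht.2⟩) (List.forall_mem_append.2 ⟨hnew, hL⟩)

/-- The codes of the elements generated by elements with codes `gs`. -/
def span (gs : List ℕ) : List ℕ := grow gs 121 [onec] [onec] (2 ^ onec)

/-- The list `L` contains the code of the identity and is closed under multiplication by `gs`. -/
def closed (gs L : List ℕ) : Bool :=
  (mask L).testBit onec && L.all fun n => gs.all fun g => (mask L).testBit (mulc n g)

/-- The entries of `L` are the codes of the elements of the subgroup `H`. -/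
def Lists (L : List ℕ) (H : Subgroup A5C2) : Prop := ∀ n, n ∈ L ↔ ∃ x ∈ H, altCode x = n

theorem Lists.mem_iff {L : List ℕ} {H : Subgroup A5C2} (h : Lists L H) (x : A5C2) :
    altCode x ∈ L ↔ x ∈ H := by
  rw [h]
  exact ⟨fun ⟨y, hy, e⟩ => altCode_injective e ▸ hy, fun hx => ⟨x, hx, rfl⟩⟩

theorem Lists.testBit_mask {L : List ℕ} {H : Subgroup A5C2} (h : Lists L H) (x : A5C2) :
    (mask L).testBit (altCode x) = true ↔ x ∈ H := by
  rw [A5TimesC2.testBit_mask, h.mem_iff]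

theorem Lists.forall_iff {L : List ℕ} {H : Subgroup A5C2} (h : Lists L H) {p : ℕ → Prop} :
    (∀ n ∈ L, p n) ↔ ∀ x ∈ H, p (altCode x) := by
  constructor
  · exact fun hp x hx => hp _ ((h.mem_iff x).2 hx)
  · intro hp n hn
    obtain ⟨x, hx, rfl⟩ := (h n).1 hn
    exact hp x hx

theorem lists_span {gs : List A5C2} (h : closed (gs.map altCode) (span (gs.map altCode)) = true) :
    Lists (span (gs.map altCode)) (Subgroup.closure {g | g ∈ gs}) := by
  simp only [closed, Bool.and_eq_true, List.all_eq_true, testBit_mask, List.forall_mem_map] at h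
  intro n
  constructor
  · refine forall_mem_grow (p := fun n => ∃ x ∈ Subgroup.closure {g | g ∈ gs}, altCode x = n)
      ?_ _ _ _ _ (List.forall_mem_singleton.2 ⟨1, one_mem _, altCode_one⟩)
      (List.forall_mem_singleton.2 ⟨1, one_mem _, altCode_one⟩) n
    rintro _ ⟨x, hx, rfl⟩ _ hg
    obtain ⟨g, hg', rfl⟩ := List.mem_map.1 hg
    exact ⟨x * g, mul_mem hx (Subgroup.subset_closure hg'), altCode_mul x g⟩
  · rintro ⟨x, hx, rfl⟩
    rw [← Subgroup.mem_toSubmonoid, Subgroup.closure_toSubmonoid_of_finite] at hx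
    induction hx using Submonoid.closure_induction_right with
    | one => rw [altCode_one]; exact h.1
    | mul_right x hx y hy ih => rw [altCode_mul]; exact h.2 _ ih y hy

theorem lists_span_pair {a b : A5C2}
    (h : closed [altCode a, altCode b] (span [altCode a, altCode b]) = true) :
    Lists (span [altCode a, altCode b]) (Subgroup.closure {a, b}) := by
  have e : ({a, b} : Set A5C2) = {g | g ∈ [a, b]} := Set.ext fun x => by simp
  exact e ▸ lists_span (gs := [a, b]) h

theorem lists_span_triple {a b c : A5C2}
    (h : closed [altCode a, altCode b, altCode c] (span [altCode a, altCode b, altCode c]) = true) :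
    Lists (span [altCode a, altCode b, altCode c]) (Subgroup.closure {a, b, c}) := by
  have e : ({a, b, c} : Set A5C2) = {g | g ∈ [a, b, c]} := Set.ext fun x => by simp
  exact e ▸ lists_span (gs := [a, b, c]) h

theorem lists_span_singleton {a : A5C2} (h : closed [altCode a] (span [altCode a]) = true) :
    Lists (span [altCode a]) (Subgroup.closure {a}) := by
  have e : ({a} : Set A5C2) = {g | g ∈ [a]} := Set.ext fun x => by simp
  exact e ▸ lists_span (gs := [a]) h

/-- The codes of all elements of `A₅ × C₂`. -/
def allCodes : List ℕ := span [194, 2826, 970, 6055]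

theorem lists_allCodes : Lists allCodes ⊤ := by
  have hmem : ∀ g : A5C2, altCode g ∈ allCodes := by decide +kernel
  have hgens : ∀ n ∈ [194, 2826, 970, 6055], ∃ g : A5C2, altCode g = n := by decide +kernel
  intro n
  constructor
  · intro hn
    suffices ∃ g : A5C2, altCode g = n from
      this.imp fun x hx => ⟨Subgroup.mem_top x, hx⟩
    refine forall_mem_grow (p := fun n => ∃ g : A5C2, altCode g = n) ?_ _ _ _ _
      (List.forall_mem_singleton.2 ⟨1, altCode_one⟩)
      (List.forall_mem_singleton.2 ⟨1, altCode_one⟩) n hn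
    rintro _ ⟨x, rfl⟩ k hk
    obtain ⟨g, rfl⟩ := hgens k hk
    exact ⟨x * g, altCode_mul x g⟩
  · rintro ⟨x, -, rfl⟩
    exact hmem x

/-- The list `L` contains all codes of elements of `A₅ × C₂`. -/
def full (L : List ℕ) : Bool := allCodes.all fun n => (mask L).testBit n

theorem Lists.full_iff {L : List ℕ} {H : Subgroup A5C2} (h : Lists L H) :
    full L = true ↔ H = ⊤ := by
  rw [full, List.all_eq_true, lists_allCodes.forall_iff, Subgroup.eq_top_iff']
  simp [h.testBit_mask]

/-- The intersection condition and the product condition for subgroups with lists of codes `H` and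
`K` that should meet in the subgroup with list of codes `C`. -/
def linear (H K C : List ℕ) : Bool :=
  (H.all fun h => !(mask K).testBit h || (mask C).testBit h) &&
  H.all fun h => K.all fun k =>
    (mask H ||| mask K).testBit (mulc h k) ||
      K.all fun l => !(mask H).testBit (mulc l (mulc h k))

open Pointwise in
theorem mul_inter_mul_eq_union_iff {G : Type*} [Group G] (H K : Subgroup G) :
    ((H : Set G) * (K : Set G)) ∩ ((K : Set G) * (H : Set G)) = (H : Set G) ∪ (K : Set G) ↔
      ∀ h ∈ H, ∀ k ∈ K, (h * k ∈ H ∨ h * k ∈ K) ∨ ∀ l ∈ K, l * (h * k) ∉ H := by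
  constructor
  · intro e h hh k hk
    by_contra! hc
    obtain ⟨⟨h1, h2⟩, l, hl, hlh⟩ := hc
    have : h * k ∈ (H : Set G) ∪ (K : Set G) := by
      rw [← e]
      exact ⟨Set.mul_mem_mul hh hk, l⁻¹, inv_mem hl, l * (h * k), hlh, by group⟩
    exact this.elim h1 h2
  · intro hc
    ext x
    constructor
    · rintro ⟨⟨h, hh, k, hk, rfl⟩, l, hl, m, hm, e⟩
      rcases hc h hh k hk with h1 | h1
      · exact h1
      · refine absurd ?_ (h1 l⁻¹ (inv_mem hl))
        have : l⁻¹ * (h * k) = m := by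
          rw [inv_mul_eq_iff_eq_mul]; exact e.symm
        rwa [this]
    · rintro (hx | hx)
      · exact ⟨⟨x, hx, 1, one_mem K, mul_one x⟩, 1, one_mem K, x, hx, one_mul x⟩
      · exact ⟨⟨1, one_mem H, x, hx, one_mul x⟩, x, hx, 1, one_mem H, mul_one x⟩

open Pointwise in
theorem linear_iff {H K C : Subgroup A5C2} {LH LK LC : List ℕ} (hH : Lists LH H) (hK : Lists LK K)
    (hC : Lists LC C) (hCH : C ≤ H) (hCK : C ≤ K) :
    linear LH LK LC = true ↔ H ⊓ K = C ∧ ((H : Set A5C2) * (K : Set A5C2)) ∩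
      ((K : Set A5C2) * (H : Set A5C2)) = (H : Set A5C2) ∪ (K : Set A5C2) := by
  have hinf : H ⊓ K = C ↔ ∀ x ∈ H, x ∉ K ∨ x ∈ C := by
    rw [le_antisymm_iff, and_iff_left (le_inf hCH hCK)]
    simp only [SetLike.le_def, Subgroup.mem_inf, and_imp, imp_iff_not_or (a := _ ∈ K)]
  rw [hinf, mul_inter_mul_eq_union_iff]
  simp only [linear, Bool.and_eq_true, List.all_eq_true, Bool.or_eq_true, Bool.not_eq_true',
    Nat.testBit_or, hH.forall_iff, hK.forall_iff, ← altCode_mul, ← Bool.not_eq_true,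
    hH.testBit_mask, hK.testBit_mask, hC.testBit_mask]

/-- A test that establishes all conditions on a triple of distinct involutions. -/
def isGood (a b c : ℕ) : Bool :=
  closed [c] (span [c]) && closed [b, c] (span [b, c]) && closed [a, c] (span [a, c]) &&
    closed [a, b, c] (span [a, b, c]) && linear (span [b, c]) (span [a, c]) (span [c]) &&
      full (span [a, b, c])

/-- A test that refutes one of the conditions on a triple. -/
def isBad (a b c : ℕ) : Bool :=
  (closed [c] (span [c]) && closed [b, c] (span [b, c]) && closed [a, c] (span [a, c]) &&
      !linear (span [b, c]) (span [a, c]) (span [c])) ||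
    (closed [a, b, c] (span [a, b, c]) && !full (span [a, b, c]))

open Pointwise in
theorem linear_span_iff {a b c : A5C2} (h₁ : closed [altCode c] (span [altCode c]) = true)
    (h₂ : closed [altCode b, altCode c] (span [altCode b, altCode c]) = true)
    (h₃ : closed [altCode a, altCode c] (span [altCode a, altCode c]) = true) :
    linear (span [altCode b, altCode c]) (span [altCode a, altCode c]) (span [altCode c]) = true ↔
      Subgroup.closure {b, c} ⊓ Subgroup.closure {a, c} = Subgroup.closure {c} ∧
      ((Subgroup.closure {b, c} : Set A5C2) * (Subgroup.closure {a, c} : Set A5C2)) ∩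
          ((Subgroup.closure {a, c} : Set A5C2) * (Subgroup.closure {b, c} : Set A5C2)) =
        (Subgroup.closure {b, c} : Set A5C2) ∪ (Subgroup.closure {a, c} : Set A5C2) :=
  linear_iff (lists_span_pair h₂) (lists_span_pair h₃) (lists_span_singleton h₁)
    (Subgroup.closure_mono (by simp)) (Subgroup.closure_mono (by simp))

theorem isRLHTriple_of_isGood {a b c : A5C2} (ha : orderOf a = 2) (hb : orderOf b = 2)
    (hc : orderOf c = 2) (hab : a ≠ b) (hac : a ≠ c) (hbc : b ≠ c)
    (h : isGood (altCode a) (altCode b) (altCode c) = true) : IsRLHTriple a b c := by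
  simp only [isGood, Bool.and_eq_true] at h
  obtain ⟨⟨⟨⟨⟨h₁, h₂⟩, h₃⟩, h₄⟩, h₅⟩, h₆⟩ := h
  exact ⟨ha, hb, hc, hab, hac, hbc, (lists_span_triple h₄).full_iff.1 h₆,
    (linear_span_iff h₁ h₂ h₃).1 h₅⟩

theorem not_isRLHTriple_of_isBad {a b c : A5C2}
    (h : isBad (altCode a) (altCode b) (altCode c) = true) : ¬ IsRLHTriple a b c := by
  rintro ⟨-, -, -, -, -, -, hgen, hlin⟩
  simp only [isBad, Bool.or_eq_true, Bool.and_eq_true, Bool.not_eq_true', ← Bool.not_eq_true] at h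
  rcases h with ⟨⟨⟨h₁, h₂⟩, h₃⟩, h₅⟩ | ⟨h₄, h₆⟩
  · exact h₅ ((linear_span_iff h₁ h₂ h₃).2 hlin)
  · exact h₆ ((lists_span_triple h₄).full_iff.2 hgen)

open Pointwise in
theorem isRLHTriple_map {G : Type*} [Group G] {a b c : G} (τ : G ≃* G) (h : IsRLHTriple a b c) :
    IsRLHTriple (τ a) (τ b) (τ c) := by
  obtain ⟨ha, hb, hc, hab, hac, hbc, hgen, hinf, hprod⟩ := h
  have hcl (s : Set G) : Subgroup.closure (τ '' s) = (Subgroup.closure s).map (τ : G →* G) :=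
    (MonoidHom.map_closure (τ : G →* G) s).symm
  have hcoe (H : Subgroup G) : (H.map (τ : G →* G) : Set G) = τ '' H := rfl
  have h₁ := hcl {a, b, c}
  have h₂ := hcl {b, c}
  have h₃ := hcl {a, c}
  have h₄ := hcl {c}
  simp only [Set.image_insert_eq, Set.image_singleton] at h₁ h₂ h₃ h₄
  refine ⟨(MulEquiv.orderOf_eq τ a).trans ha, (MulEquiv.orderOf_eq τ b).trans hb,
    (MulEquiv.orderOf_eq τ c).trans hc, τ.injective.ne hab, τ.injective.ne hac,
    τ.injective.ne hbc, ?_, ?_, ?_⟩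
  · rw [h₁, hgen, Subgroup.map_equiv_top]
  · rw [h₂, h₃, h₄, ← hinf, Subgroup.map_inf _ _ _ τ.injective]
  · rw [h₂, h₃, hcoe, hcoe, ← Set.image_mul, ← Set.image_mul, ← Set.image_inter τ.injective,
      ← Set.image_union, hprod]

theorem closure_pair_eq_top_map_iff {G : Type*} [Group G] (τ : G ≃* G) (a b : G) :
    Subgroup.closure {τ a, τ b} = ⊤ ↔ Subgroup.closure {a, b} = ⊤ := by
  have h := MonoidHom.map_closure (τ : G →* G) {a, b}
  simp only [Set.image_insert_eq, Set.image_singleton, MonoidHom.coe_coe] at h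
  rw [← h, ← Subgroup.map_equiv_top τ,
    (Subgroup.map_injective (f := (τ : G →* G)) τ.injective).eq_iff, Subgroup.map_equiv_top]

/-- The automorphism of `A₅ × C₂` induced by conjugation with a permutation. -/
def conjAut (σ : Equiv.Perm (Fin 5)) : A5C2 ≃* A5C2 :=
  MulEquiv.prodCongr (MulAut.conjNormal σ) (MulEquiv.refl _)

/-- Conjugation with a permutation on codes. -/
def conjCode (σ : Equiv.Perm (Fin 5)) (n : ℕ) : ℕ :=
  mulc (mulc (code (σ, 1)) n) (code (σ⁻¹, 1))

theorem altCode_conjAut (σ : Equiv.Perm (Fin 5)) (g : A5C2) :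
    altCode (conjAut σ g) = conjCode σ (altCode g) := by
  rw [conjCode, altCode, altCode, ← code_mul, ← code_mul]
  congr 1
  exact Prod.ext rfl ((mul_one _ : g.2 * 1 = g.2).symm.trans
    (congrArg (· * 1) (one_mul g.2).symm))

/-- The codes of the involutions of `A₅ × C₂`. -/
def involutionCodes : List ℕ :=
  [194, 334, 414, 698, 970, 1022, 1358, 1490, 1726, 2382, 2410, 2426, 2538, 2642, 2826, 3319,
    3459, 3539, 3823, 4095, 4147, 4483, 4615, 4851, 5507, 5535, 5551, 5663, 5767, 5951, 6055]

theorem altCode_mem_involutionCodes :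
    ∀ g : A5C2, g ^ 2 = 1 → g ≠ 1 → altCode g ∈ involutionCodes := by
  decide +kernel

theorem exists_of_mem_involutionCodes :
    ∀ n ∈ involutionCodes, ∃ g : A5C2, (g ^ 2 = 1 ∧ g ≠ 1) ∧ altCode g = n := by
  decide +kernel

/-- The centralizer of the double transposition `(0 1)(2 3)` in the symmetric group. -/
def centralizerPerms : List (Equiv.Perm (Fin 5)) :=
  open Equiv in
  [1, swap 0 1, swap 2 3, swap 0 1 * swap 2 3, swap 0 2 * swap 1 3, swap 0 3 * swap 1 2,
    swap 0 1 * (swap 0 2 * swap 1 3), swap 2 3 * (swap 0 2 * swap 1 3)]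

/-- Codes of involutions representing the conjugacy classes. -/
def classReps : List ℕ := [2826, 5951, 6055]

/-- Codes of involutions representing the orbits of the centralizer of a double transposition. -/
def centralizerReps : List ℕ := [6055, 2410, 5535, 970, 4095, 2826, 5951, 2642, 5767]

/-- Codes of representatives of the orbits of triples, the orientable ones first. -/
def tripleReps : Fin 19 → ℕ × ℕ × ℕ :=
  ![(5767, 5535, 5951), (5663, 5535, 5951), (5551, 4095, 5951), (5767, 4095, 5951),
    (5535, 5767, 5951), (4615, 5767, 5951), (4095, 5767, 5951), (5767, 2410, 2826),
    (5663, 2410, 2826), (5767, 970, 2826), (2410, 5767, 2826), (1490, 5767, 2826),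
    (970, 5767, 2826), (2642, 5535, 5951), (2538, 5535, 5951), (2642, 4095, 5951),
    (5535, 2642, 5951), (4615, 2642, 5951), (4095, 2642, 5951)]

theorem exists_conjCode_mem_classReps :
    ∀ c ∈ involutionCodes, ∃ σ : Equiv.Perm (Fin 5), conjCode σ c ∈ classReps := by
  decide +kernel

theorem exists_conjCode_mem_centralizerReps :
    ∀ c ∈ classReps, ∀ b ∈ involutionCodes, ∃ σ ∈ centralizerPerms,
      conjCode σ c = c ∧ conjCode σ b ∈ centralizerReps := by
  decide +kernel

theorem isBad_or_exists_tripleReps :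
    ∀ c ∈ classReps, ∀ b ∈ centralizerReps, ∀ a ∈ involutionCodes, isBad a b c = true ∨
      ∃ σ ∈ centralizerPerms, ∃ i : Fin 19,
        tripleReps i = (conjCode σ a, conjCode σ b, conjCode σ c) := by
  decide +kernel

theorem isGood_tripleReps :
    ∀ i : Fin 19, isGood (tripleReps i).1 (tripleReps i).2.1 (tripleReps i).2.2 = true := by
  decide +kernel

theorem tripleReps_mem :
    ∀ i : Fin 19, ((tripleReps i).1 ∈ involutionCodes ∧ (tripleReps i).2.1 ∈ involutionCodes ∧
      (tripleReps i).2.2 ∈ involutionCodes) ∧ (tripleReps i).1 ≠ (tripleReps i).2.1 ∧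
      (tripleReps i).1 ≠ (tripleReps i).2.2 ∧ (tripleReps i).2.1 ≠ (tripleReps i).2.2 := by
  decide +kernel

/-- The span of the rotations of a representative has been computed completely, and it is
everything unless the representative is one of the first seven. -/
theorem rotations_tripleReps :
    ∀ i : Fin 19, ∀ L, L = [mulc (tripleReps i).1 (tripleReps i).2.2,
        mulc (tripleReps i).2.1 (tripleReps i).2.2] →
      closed L (span L) = true ∧ (full (span L) = true ↔ 7 ≤ i) := by
  simp only [forall_eq]
  decide +kernel

/-- The value of a word in the codes of a triple. -/
def wordCode (t : ℕ × ℕ × ℕ) (w : List (Fin 3)) : ℕ :=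
  w.foldr (fun i n => mulc (![t.1, t.2.1, t.2.2] i) n) onec

/-- The value of a word in the elements of a triple. -/
def wordValue {G : Type*} [Group G] (t : G × G × G) (w : List (Fin 3)) : G :=
  w.foldr (fun i x => ![t.1, t.2.1, t.2.2] i * x) 1

/-- Words whose triviality separates the representatives of the orbits. -/
def separatingWords : List (List (Fin 3)) :=
  [[0, 2], [1, 2], [0, 1], [0, 1, 2]].flatMap fun w =>
    [2, 3, 5, 6].map fun n => (List.replicate n w).flatten

theorem map_wordValue {G : Type*} [Group G] (τ : G ≃* G) (t : G × G × G) (w : List (Fin 3)) :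
    τ (wordValue t w) = wordValue (τ t.1, τ t.2.1, τ t.2.2) w := by
  induction w with
  | nil => exact map_one τ
  | cons i w ih =>
    rw [wordValue, List.foldr_cons, map_mul, ← wordValue, ih]
    rw [wordValue, wordValue, List.foldr_cons]
    congr 1
    fin_cases i <;> rfl

theorem altCode_wordValue (t : A5C2 × A5C2 × A5C2) (w : List (Fin 3)) :
    altCode (wordValue t w) = wordCode (altCode t.1, altCode t.2.1, altCode t.2.2) w := by
  induction w with
  | nil => exact altCode_one
  | cons i w ih =>
    rw [wordValue, List.foldr_cons, altCode_mul, ← wordValue, ih]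
    rw [wordCode, wordCode, List.foldr_cons]
    congr 1
    fin_cases i <;> rfl

theorem tripleReps_separated :
    (List.ofFn fun i => separatingWords.map fun w => wordCode (tripleReps i) w == onec).Nodup := by
  decide +kernel

theorem exists_representatives :
    ∃ r : Fin 19 → {t : A5C2 × A5C2 × A5C2 // IsRLHTriple t.1 t.2.1 t.2.2}, ∀ i,
      (altCode (r i).val.1, altCode (r i).val.2.1, altCode (r i).val.2.2) = tripleReps i := by
  have key : ∀ i, ∃ t : {t : A5C2 × A5C2 × A5C2 // IsRLHTriple t.1 t.2.1 t.2.2},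
      (altCode t.val.1, altCode t.val.2.1, altCode t.val.2.2) = tripleReps i := by
    intro i
    obtain ⟨⟨ha, hb, hc⟩, hab, hac, hbc⟩ := tripleReps_mem i
    have hgood := isGood_tripleReps i
    obtain ⟨a, ha, ea⟩ := exists_of_mem_involutionCodes _ ha
    obtain ⟨b, hb, eb⟩ := exists_of_mem_involutionCodes _ hb
    obtain ⟨c, hc, ec⟩ := exists_of_mem_involutionCodes _ hc
    rw [← ea, ← eb, ← ec] at hgood
    rw [← ea, ← eb] at hab
    rw [← ea, ← ec] at hac
    rw [← eb, ← ec] at hbc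
    exact ⟨⟨(a, b, c), isRLHTriple_of_isGood (orderOf_eq_prime ha.1 ha.2)
      (orderOf_eq_prime hb.1 hb.2) (orderOf_eq_prime hc.1 hc.2) (ne_of_apply_ne _ hab)
      (ne_of_apply_ne _ hac) (ne_of_apply_ne _ hbc) hgood⟩,
      Prod.ext ea (Prod.ext eb ec)⟩
  choose r hr using key
  exact ⟨r, hr⟩

theorem exists_aut_altCode_eq_tripleReps {a b c : A5C2} (h : IsRLHTriple a b c) :
    ∃ (τ : A5C2 ≃* A5C2) (i : Fin 19),
      tripleReps i = (altCode (τ a), altCode (τ b), altCode (τ c)) := by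
  have hinv {x : A5C2} (hx : orderOf x = 2) : altCode x ∈ involutionCodes :=
    by
    refine altCode_mem_involutionCodes x (orderOf_dvd_iff_pow_eq_one.1 hx.dvd) fun e => ?_
    rw [e, orderOf_one] at hx
    exact absurd hx (by decide)
  obtain ⟨σ, hσ⟩ := exists_conjCode_mem_classReps _ (hinv h.2.2.1)
  rw [← altCode_conjAut] at hσ
  replace h := isRLHTriple_map (conjAut σ) h
  obtain ⟨ρ, -, hρc, hρb⟩ :=
    exists_conjCode_mem_centralizerReps _ hσ _ (hinv h.2.1)
  rw [← altCode_conjAut] at hρc hρb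
  replace h := isRLHTriple_map (conjAut ρ) h
  rw [← hρc] at hσ
  obtain hbad | ⟨π, -, i, hi⟩ := isBad_or_exists_tripleReps _ hσ _ hρb _ (hinv h.1)
  · exact absurd h (not_isRLHTriple_of_isBad hbad)
  · simp only [← altCode_conjAut] at hi
    exact ⟨((conjAut σ).trans (conjAut ρ)).trans (conjAut π), i, hi⟩

theorem card_quotient_subtype {X ι : Type*} (s : Setoid X) {P : X → Prop}
    (hP : ∀ x y, s.r x y → (P x ↔ P y)) (r : ι → X) (hinj : ∀ i j, s.r (r i) (r j) → i = j)
    (hsurj : ∀ x, ∃ i, s.r (r i) x) :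
    Nat.card {c : Quotient s // ∀ t, Quotient.mk s t = c → P t} = Nat.card {i // P (r i)} := by
  symm
  refine Nat.card_eq_of_bijective
    (fun i => ⟨Quotient.mk s (r i), fun t ht => (hP _ _ (Quotient.exact ht)).2 i.2⟩) ⟨?_, ?_⟩
  · intro i j e
    exact Subtype.ext (hinj _ _ (Quotient.exact (congrArg Subtype.val e)))
  · rintro ⟨c, hc⟩
    obtain ⟨x, rfl⟩ := Quotient.exists_rep c
    obtain ⟨i, hi⟩ := hsurj x
    exact ⟨⟨i, (hP _ _ hi).2 (hc x rfl)⟩, Subtype.ext (Quotient.sound hi)⟩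

theorem exists_orbit_representatives :
    ∃ r : Fin 19 → {t : A5C2 × A5C2 × A5C2 // IsRLHTriple t.1 t.2.1 t.2.2},
      (∀ i j, (RLHTripleSetoid A5C2).r (r i) (r j) → i = j) ∧
      (∀ x, ∃ i, (RLHTripleSetoid A5C2).r (r i) x) ∧
      ∀ i, Subgroup.closure {(r i).val.1 * (r i).val.2.2, (r i).val.2.1 * (r i).val.2.2} = ⊤ ↔
        7 ≤ i := by
  obtain ⟨r, hr⟩ := exists_representatives
  refine ⟨r, ?_, ?_, ?_⟩
  · rintro i j ⟨τ, h₀, h₁, h₂⟩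
    refine List.nodup_ofFn.1 tripleReps_separated (List.map_congr_left fun w _ => ?_)
    have hone (k : Fin 19) : wordCode (tripleReps k) w = onec ↔ wordValue (r k).val w = 1 := by
      rw [← hr, ← altCode_wordValue, ← altCode_one, altCode_injective.eq_iff]
    have hτ := map_wordValue τ (r i).val w
    rw [h₀, h₁, h₂] at hτ
    rw [Bool.eq_iff_iff, beq_iff_eq, beq_iff_eq, hone, hone, ← map_eq_one_iff τ τ.injective, hτ]
  · rintro ⟨⟨a, b, c⟩, hx⟩
    obtain ⟨τ, i, hi⟩ := exists_aut_altCode_eq_tripleReps hx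
    rw [← hr, Prod.mk.injEq, Prod.mk.injEq] at hi
    exact ⟨i, (RLHTripleSetoid A5C2).symm ⟨τ, altCode_injective hi.1.symm,
      altCode_injective hi.2.1.symm, altCode_injective hi.2.2.symm⟩⟩
  · intro i
    obtain ⟨h₁, h₂⟩ := rotations_tripleReps i _ rfl
    rw [← hr] at h₁ h₂
    simp only [← altCode_mul] at h₁ h₂
    rw [← h₂]
    exact (lists_span_pair h₁).full_iff.symm

end A5TimesC2

theorem stmt_14 :
    Nat.card {c : Quotient
        (RLHTripleSetoid (alternatingGroup (Fin 5) × Multiplicative (ZMod 2))) //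
      ∀ t, Quotient.mk
          (RLHTripleSetoid (alternatingGroup (Fin 5) × Multiplicative (ZMod 2))) t = c →
        Subgroup.closure {t.val.1 * t.val.2.2, t.val.2.1 * t.val.2.2} ≠ ⊤} = 7 ∧
    Nat.card {c : Quotient
        (RLHTripleSetoid (alternatingGroup (Fin 5) × Multiplicative (ZMod 2))) //
      ∀ t, Quotient.mk
          (RLHTripleSetoid (alternatingGroup (Fin 5) × Multiplicative (ZMod 2))) t = c →
        Subgroup.closure {t.val.1 * t.val.2.2, t.val.2.1 * t.val.2.2} = ⊤} = 12 := by
  obtain ⟨r, hinj, hsurj, htop⟩ := A5TimesC2.exists_orbit_representatives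
  have hinv : ∀ s t, (RLHTripleSetoid A5TimesC2.A5C2).r s t →
      (Subgroup.closure {s.val.1 * s.val.2.2, s.val.2.1 * s.val.2.2} = ⊤ ↔
        Subgroup.closure {t.val.1 * t.val.2.2, t.val.2.1 * t.val.2.2} = ⊤) := by
    rintro s t ⟨τ, h₀, h₁, h₂⟩
    rw [← h₀, ← h₁, ← h₂, ← map_mul, ← map_mul, A5TimesC2.closure_pair_eq_top_map_iff]
  constructor
  · refine (A5TimesC2.card_quotient_subtype _ (fun s t h => not_congr (hinv s t h)) r hinj
      hsurj).trans ?_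
    simp only [htop]
    rw [Nat.card_eq_fintype_card]
    decide
  · refine (A5TimesC2.card_quotient_subtype _ hinv r hinj hsurj).trans ?_
    simp only [htop]
    rw [Nat.card_eq_fintype_card]
    decide
end

section
/- Let G = A₅ × C₂, where A₅ is the alternating group on {1,2,3,4,5} and a denotes the generator of the C₂ factor; write πa for the element (π, a). Set r₀ = (1 2)(3 5)a, r₁ = (1 2)(3 4)a, r₂ = (1 3)(2 4)a. Then (r₀, r₁, r₂) is a regular linear hypermap triple for G; the orders of r₁r₂, r₀r₂, r₀r₁ are 2, 5, 3 respectively; the subgroups ⟨r₁,r₂⟩, ⟨r₀,r₂⟩, ⟨r₀,r₁⟩ have indices 30, 12, 20 in G respectively; and ⟨r₀r₂, r₁r₂⟩ has index 2 in G. -/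
open Pointwise

/-- The words `(r * s) ^ i * s ^ j` with `i < n` and `j < 2`. When `r` and `s` are involutions and
`(r * s) ^ n = 1`, these are the elements of the dihedral group generated by `r` and `s`. -/
def dihedralWords {G : Type*} [Group G] [DecidableEq G] (r s : G) (n : ℕ) : Finset G :=
  (Finset.range n ×ˢ Finset.range 2).image fun p => (r * s) ^ p.1 * s ^ p.2

theorem coe_closure_pair_eq_dihedralWords {G : Type*} [Group G] [DecidableEq G] {r s : G} {n : ℕ}
    (hr : r * r = 1) (hs : s * s = 1) (hone : 1 ∈ dihedralWords r s n)
    (hmul : ∀ x ∈ dihedralWords r s n, r * x ∈ dihedralWords r s n ∧ s * x ∈ dihedralWords r s n) :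
    (Subgroup.closure {r, s} : Set G) = dihedralWords r s n := by
  have hr' : r⁻¹ = r := inv_eq_of_mul_eq_one_left hr
  have hs' : s⁻¹ = s := inv_eq_of_mul_eq_one_left hs
  have hrc : r ∈ Subgroup.closure {r, s} := Subgroup.subset_closure (by simp)
  have hsc : s ∈ Subgroup.closure {r, s} := Subgroup.subset_closure (by simp)
  ext x
  constructor
  · intro hx
    induction hx using Subgroup.closure_induction_left with
    | one => exact hone
    | mul_left y hy z _ ih =>
      rcases hy with rfl | rfl
      · exact (hmul z ih).1
      · exact (hmul z ih).2
    | inv_mul_cancel y hy z _ ih =>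
      rcases hy with rfl | rfl
      · rw [hr']; exact (hmul z ih).1
      · rw [hs']; exact (hmul z ih).2
  · intro hx
    obtain ⟨p, -, rfl⟩ := Finset.mem_image.mp (Finset.mem_coe.mp hx)
    exact mul_mem (pow_mem (mul_mem hrc hsc) _) (pow_mem hsc _)

theorem Subgroup.index_of_coe_eq_finset {G : Type*} [Group G] {H : Subgroup G} {F : Finset G}
    {k : ℕ} (hH : (H : Set G) = F) (hF : 0 < F.card) (hG : Nat.card G = F.card * k) :
    H.index = k := by
  have hcard : Nat.card H = F.card := by
    rw [← SetLike.coe_sort_coe, hH]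
    simp
  have := H.card_mul_index
  rw [hcard, hG] at this
  exact Nat.eq_of_mul_eq_mul_left hF this

theorem card_alternatingGroup_five_prod_two :
    Nat.card (alternatingGroup (Fin 5) × Multiplicative (ZMod 2)) = 120 := by
  have h2 : Nat.card (Multiplicative (ZMod 2)) = 2 :=
    (Nat.card_congr Multiplicative.toAdd).trans (Nat.card_zmod 2)
  rw [Nat.card_prod, nat_card_alternatingGroup, h2]
  simp [Nat.factorial]

theorem stmt_15
    (r₀ r₁ r₂ : alternatingGroup (Fin 5) × Multiplicative (ZMod 2))
    (hr₀ : r₀ = (⟨Equiv.swap 0 1 * Equiv.swap 2 4, by simp [Equiv.Perm.mem_alternatingGroup]⟩, Multiplicative.ofAdd 1))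
    (hr₁ : r₁ = (⟨Equiv.swap 0 1 * Equiv.swap 2 3, by simp [Equiv.Perm.mem_alternatingGroup]⟩, Multiplicative.ofAdd 1))
    (hr₂ : r₂ = (⟨Equiv.swap 0 2 * Equiv.swap 1 3, by simp [Equiv.Perm.mem_alternatingGroup]⟩, Multiplicative.ofAdd 1)) :
    IsRLHTriple r₀ r₁ r₂ ∧
    orderOf (r₁ * r₂) = 2 ∧ orderOf (r₀ * r₂) = 5 ∧ orderOf (r₀ * r₁) = 3 ∧
    (Subgroup.closure {r₁, r₂}).index = 30 ∧
    (Subgroup.closure {r₀, r₂}).index = 12 ∧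
    (Subgroup.closure {r₀, r₁}).index = 20 ∧
    (Subgroup.closure {r₀ * r₂, r₁ * r₂}).index = 2 := by
  have hG := card_alternatingGroup_five_prod_two
  have h00 : r₀ * r₀ = 1 := by subst hr₀; decide +kernel
  have h11 : r₁ * r₁ = 1 := by subst hr₁; decide +kernel
  have h22 : r₂ * r₂ = 1 := by subst hr₂; decide +kernel
  have hne0 : r₀ ≠ 1 := by subst hr₀; decide +kernel
  have hne1 : r₁ ≠ 1 := by subst hr₁; decide +kernel
  have hne2 : r₂ ≠ 1 := by subst hr₂; decide +kernel
  have ord12 : orderOf (r₁ * r₂) = 2 :=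
    orderOf_eq_prime (by subst hr₁ hr₂; decide +kernel) (by subst hr₁ hr₂; decide +kernel)
  have : Fact (Nat.Prime 5) := ⟨by norm_num⟩
  have ord02 : orderOf (r₀ * r₂) = 5 :=
    orderOf_eq_prime (by subst hr₀ hr₂; decide +kernel) (by subst hr₀ hr₂; decide +kernel)
  have ord01 : orderOf (r₀ * r₁) = 3 :=
    orderOf_eq_prime (by subst hr₀ hr₁; decide +kernel) (by subst hr₀ hr₁; decide +kernel)
  have c12 :=
    coe_closure_pair_eq_dihedralWords (n := 2) h11 h22
      (by subst hr₁ hr₂; decide +kernel) (by subst hr₁ hr₂; decide +kernel)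
  have c02 :=
    coe_closure_pair_eq_dihedralWords (n := 5) h00 h22
      (by subst hr₀ hr₂; decide +kernel) (by subst hr₀ hr₂; decide +kernel)
  have c01 :=
    coe_closure_pair_eq_dihedralWords (n := 3) h00 h11
      (by subst hr₀ hr₁; decide +kernel) (by subst hr₀ hr₁; decide +kernel)
  have d12 : (dihedralWords r₁ r₂ 2).card = 4 := by subst hr₁ hr₂; decide +kernel
  have d02 : (dihedralWords r₀ r₂ 5).card = 10 := by subst hr₀ hr₂; decide +kernel
  have d01 : (dihedralWords r₀ r₁ 3).card = 6 := by subst hr₀ hr₁; decide +kernel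
  set K := Subgroup.closure {r₀ * r₂, r₁ * r₂} with hK
  have hp : r₀ * r₂ ∈ K := Subgroup.subset_closure (by simp)
  have hq : r₁ * r₂ ∈ K := Subgroup.subset_closure (by simp)
  have hKsnd : K ≤ (MonoidHom.snd _ _ : _ →* Multiplicative (ZMod 2)).ker := by
    rw [hK, Subgroup.closure_le]
    rintro x (rfl | rfl)
    · subst hr₀ hr₂; exact MonoidHom.mem_ker.mpr (by decide +kernel)
    · subst hr₁ hr₂; exact MonoidHom.mem_ker.mpr (by decide +kernel)
  have hr₀K : r₀ ∉ K := fun h => by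
    have h' := MonoidHom.mem_ker.mp (hKsnd h)
    subst hr₀
    exact absurd h' (by decide +kernel)
  have h5 : 5 ∣ Nat.card K := ord02.symm.dvd.trans (Subgroup.orderOf_dvd_natCard K hp)
  have h3 : 3 ∣ Nat.card K := by
    have hmem : r₀ * r₁ ∈ K := by
      have := mul_mem hp (inv_mem hq)
      rwa [mul_inv_rev, mul_assoc, mul_inv_cancel_left,
        inv_eq_of_mul_eq_one_left h11] at this
    exact ord01 ▸ Subgroup.orderOf_dvd_natCard K hmem
  -- `q` and `y` generate a Klein four-group inside `K`.
  have h4 : 4 ∣ Nat.card K := by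
    obtain ⟨q, hqdef⟩ : ∃ q, q = r₁ * r₂ := ⟨_, rfl⟩
    obtain ⟨y, hydef⟩ : ∃ y, y = (r₀ * r₂) ^ 2 * q * (r₀ * r₂) ^ 3 * q * (r₀ * r₂) ^ 2 := ⟨_, rfl⟩
    have hqK : q ∈ K := hqdef ▸ hq
    have hyK : y ∈ K := hydef ▸ mul_mem (mul_mem (mul_mem (mul_mem (pow_mem hp _) hqK)
      (pow_mem hp _)) hqK) (pow_mem hp _)
    have hle : Subgroup.closure {q, y} ≤ K := by
      rw [Subgroup.closure_le]
      rintro x (rfl | rfl)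
      exacts [hqK, hyK]
    have cV : (Subgroup.closure {q, y} :
        Set (alternatingGroup (Fin 5) × Multiplicative (ZMod 2))) = dihedralWords q y 2 := by
      clear_value K
      subst hydef hqdef hr₀ hr₁ hr₂
      exact coe_closure_pair_eq_dihedralWords (n := 2) (by decide +kernel) (by decide +kernel)
        (by decide +kernel) (by decide +kernel)
    have dV : (dihedralWords q y 2).card = 4 := by
      clear_value K
      subst hydef hqdef hr₀ hr₁ hr₂
      decide +kernel
    have hcard : Nat.card (Subgroup.closure {q, y}) = 4 := by
      rw [← SetLike.coe_sort_coe, cV]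
      simpa using dV
    exact hcard ▸ Subgroup.card_dvd_of_le hle
  have hKindex : K.index = 2 := by
    have hmul := K.card_mul_index
    rw [hG] at hmul
    have h60 : 60 ∣ Nat.card K := by omega
    obtain ⟨m, hm⟩ := h60
    have hne : K.index ≠ 1 := fun h =>
      hr₀K (Subgroup.index_eq_one.mp h ▸ Subgroup.mem_top r₀)
    have hm2 : m * K.index = 2 := by
      rw [hm, mul_assoc] at hmul
      omega
    exact ((Nat.dvd_prime Nat.prime_two).mp ⟨m, by rw [mul_comm, hm2]⟩).resolve_left hne
  have hgen : Subgroup.closure {r₀, r₁, r₂} = ⊤ := by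
    have m0 : r₀ ∈ Subgroup.closure {r₀, r₁, r₂} := Subgroup.subset_closure (by simp)
    have m1 : r₁ ∈ Subgroup.closure {r₀, r₁, r₂} := Subgroup.subset_closure (by simp)
    have m2 : r₂ ∈ Subgroup.closure {r₀, r₁, r₂} := Subgroup.subset_closure (by simp)
    have hle : K ≤ Subgroup.closure {r₀, r₁, r₂} := by
      rw [hK, Subgroup.closure_le]
      rintro x (rfl | rfl)
      exacts [mul_mem m0 m2, mul_mem m1 m2]
    have hmul := Subgroup.relIndex_mul_index hle
    rw [hKindex] at hmul
    rcases (Nat.dvd_prime Nat.prime_two).mp ⟨_, hmul.symm⟩ with h | h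
    · exact absurd (Subgroup.relIndex_eq_one.mp h m0) hr₀K
    · rw [h] at hmul
      exact Subgroup.index_eq_one.mp (by omega)
  refine ⟨⟨orderOf_eq_prime (by rw [pow_two, h00]) hne0, orderOf_eq_prime (by rw [pow_two, h11]) hne1,
    orderOf_eq_prime (by rw [pow_two, h22]) hne2, by subst hr₀ hr₁; decide +kernel,
    by subst hr₀ hr₂; decide +kernel, by subst hr₁ hr₂; decide +kernel, hgen, ?_, ?_⟩,
    ord12, ord02, ord01, Subgroup.index_of_coe_eq_finset c12 (by omega) (by omega),
    Subgroup.index_of_coe_eq_finset c02 (by omega) (by omega),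
    Subgroup.index_of_coe_eq_finset c01 (by omega) (by omega), hKindex⟩
  · have key : ∀ x ∈ dihedralWords r₁ r₂ 2, x ∈ dihedralWords r₀ r₂ 5 → x = 1 ∨ x = r₂ := by
      clear_value K
      subst hr₀ hr₁ hr₂
      decide +kernel
    apply le_antisymm
    · rintro x ⟨hx, hx'⟩
      rcases key x (c12.subset hx) (c02.subset hx') with rfl | rfl
      · exact one_mem _
      · exact Subgroup.mem_closure_singleton_self _
    · exact le_inf (Subgroup.closure_mono (by simp)) (Subgroup.closure_mono (by simp))
  · have key : ∀ a ∈ dihedralWords r₁ r₂ 2, ∀ b ∈ dihedralWords r₀ r₂ 5,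
        ∀ c ∈ dihedralWords r₀ r₂ 5, ∀ d ∈ dihedralWords r₁ r₂ 2, c * d = a * b →
          a * b ∈ dihedralWords r₁ r₂ 2 ∨ a * b ∈ dihedralWords r₀ r₂ 5 := by
      clear_value K
      subst hr₀ hr₁ hr₂
      decide +kernel
    apply Set.Subset.antisymm
    · rintro x ⟨⟨a, ha, b, hb, rfl⟩, c, hc, d, hd, h⟩
      rw [c12] at ha hd ⊢
      rw [c02] at hb hc ⊢
      exact key a ha b hb c hc d hd h
    · rintro x (hx | hx)
      · exact ⟨⟨x, hx, 1, one_mem _, mul_one x⟩, 1, one_mem _, x, hx, one_mul x⟩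
      · exact ⟨⟨1, one_mem _, x, hx, one_mul x⟩, x, hx, 1, one_mem _, mul_one x⟩
end

section
/- Let G = A₅ × C₂, where A₅ is the alternating group on {1,2,3,4,5} and a denotes the generator of the C₂ factor; write πa for the element (π, a). Set r₀ = (1 3)(2 4)a, r₁ = (1 2)(4 5)a, r₂ = (1 3)(4 5)a. Then (r₀, r₁, r₂) is a regular linear hypermap triple for G; the orders of r₁r₂, r₀r₂, r₀r₁ are 3, 3, 5 respectively; the subgroups ⟨r₁,r₂⟩, ⟨r₀,r₂⟩, ⟨r₀,r₁⟩ have indices 20, 20, 12 in G respectively; and ⟨r₀r₂, r₁r₂⟩ has index 2 in G. -/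
open Pointwise

/-- A finite set closed under multiplication that contains `T` and consists of elements generated
by `T` is the subgroup generated by `T`. -/
lemma Subgroup.coe_closure_eq_finset {G : Type*} [Group G] [Finite G] {T : Set G} (S : Finset G)
    (h_one : 1 ∈ S) (h_mul : ∀ a ∈ S, ∀ b ∈ S, a * b ∈ S) (hTS : T ⊆ S)
    (hS : ∀ a ∈ S, a ∈ Subgroup.closure T) : (Subgroup.closure T : Set G) = S := by
  refine Set.Subset.antisymm (fun x hx => ?_) (fun a ha => hS a ha)
  rw [SetLike.mem_coe, ← Subgroup.mem_toSubmonoid, Subgroup.closure_toSubmonoid_of_finite] at hx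
  induction hx using Submonoid.closure_induction with
  | mem x hx => exact hTS hx
  | one => exact h_one
  | mul x y _ _ hx hy => exact h_mul x hx y hy

lemma Subgroup.card_closure_eq_finset_card {G : Type*} [Group G] {T : Set G} {S : Finset G}
    (h : (Subgroup.closure T : Set G) = S) : Nat.card (Subgroup.closure T) = S.card := by
  have h_card := congrArg Set.ncard h
  rwa [Set.ncard_coe_finset, ← Nat.card_coe_set_eq] at h_card

/-- The words in `x` and `y` that exhaust `⟨x, y⟩` when `x` and `y` are involutions and `x * y` has
order three. -/
def hexad {G : Type*} [Group G] [DecidableEq G] (x y : G) : Finset G :=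
  {1, x, y, x * y, y * x, x * y * x}

/-- The words in `x` and `y` that exhaust `⟨x, y⟩` when `x` and `y` are involutions and `x * y` has
order five. -/
def decad {G : Type*} [Group G] [DecidableEq G] (x y : G) : Finset G :=
  {1, x, y, x * y, y * x, x * y * x, y * x * y, x * y * x * y, y * x * y * x, x * y * x * y * x}

lemma mem_closure_of_mem_decad {G : Type*} [Group G] [DecidableEq G] {x y a : G}
    (ha : a ∈ decad x y) : a ∈ Subgroup.closure ({x, y} : Set G) := by
  have hx : x ∈ Subgroup.closure ({x, y} : Set G) := Subgroup.subset_closure (by simp)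
  have hy : y ∈ Subgroup.closure ({x, y} : Set G) := Subgroup.subset_closure (by simp)
  simp only [decad, Finset.mem_insert, Finset.mem_singleton] at ha
  rcases ha with rfl | rfl | rfl | rfl | rfl | rfl | rfl | rfl | rfl | rfl
  · exact one_mem _
  all_goals
    repeat first | exact hx | exact hy | refine mul_mem ?_ ?_

lemma hexad_subset_decad {G : Type*} [Group G] [DecidableEq G] (x y : G) :
    hexad x y ⊆ decad x y := by
  intro a
  simp only [hexad, decad, Finset.mem_insert, Finset.mem_singleton]
  tauto

/-- The group `A₅ × C₂`. -/
abbrev AltFiveProd : Type := alternatingGroup (Fin 5) × Multiplicative (ZMod 2)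

lemma card_altFiveProd : Nat.card AltFiveProd = 120 := by
  have h : Nat.card (alternatingGroup (Fin 5)) = 60 := by
    rw [nat_card_alternatingGroup]
    simp [Nat.factorial]
  rw [Nat.card_prod, h]
  simp

/-- The involution `(1 3)(2 4)a`, on the letters `0, …, 4`. -/
def flagZero : AltFiveProd :=
  (⟨Equiv.swap 0 2 * Equiv.swap 1 3, Equiv.Perm.mem_alternatingGroup.2 (by decide +kernel)⟩,
    Multiplicative.ofAdd 1)

/-- The involution `(1 2)(4 5)a`, on the letters `0, …, 4`. -/
def flagOne : AltFiveProd :=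
  (⟨Equiv.swap 0 1 * Equiv.swap 3 4, Equiv.Perm.mem_alternatingGroup.2 (by decide +kernel)⟩,
    Multiplicative.ofAdd 1)

/-- The involution `(1 3)(4 5)a`, on the letters `0, …, 4`. -/
def flagTwo : AltFiveProd :=
  (⟨Equiv.swap 0 2 * Equiv.swap 3 4, Equiv.Perm.mem_alternatingGroup.2 (by decide +kernel)⟩,
    Multiplicative.ofAdd 1)

lemma orderOf_flagZero : orderOf flagZero = 2 :=
  orderOf_eq_prime (by decide +kernel) (by decide +kernel)

lemma orderOf_flagOne : orderOf flagOne = 2 :=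
  orderOf_eq_prime (by decide +kernel) (by decide +kernel)

lemma orderOf_flagTwo : orderOf flagTwo = 2 :=
  orderOf_eq_prime (by decide +kernel) (by decide +kernel)

lemma orderOf_flagOne_mul_flagTwo : orderOf (flagOne * flagTwo) = 3 :=
  orderOf_eq_prime (by decide +kernel) (by decide +kernel)

lemma orderOf_flagZero_mul_flagTwo : orderOf (flagZero * flagTwo) = 3 :=
  orderOf_eq_prime (by decide +kernel) (by decide +kernel)

lemma orderOf_flagZero_mul_flagOne : orderOf (flagZero * flagOne) = 5 :=
  have : Fact (Nat.Prime 5) := ⟨by norm_num⟩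
  orderOf_eq_prime (by decide +kernel) (by decide +kernel)

lemma coe_closure_flagOne_flagTwo :
    (Subgroup.closure {flagOne, flagTwo} : Set AltFiveProd) = hexad flagOne flagTwo :=
  Subgroup.coe_closure_eq_finset _ (by decide +kernel) (by decide +kernel)
    (by simp [Set.insert_subset_iff, hexad])
    fun _ ha => mem_closure_of_mem_decad (hexad_subset_decad _ _ ha)

lemma coe_closure_flagZero_flagTwo :
    (Subgroup.closure {flagZero, flagTwo} : Set AltFiveProd) = hexad flagZero flagTwo :=
  Subgroup.coe_closure_eq_finset _ (by decide +kernel) (by decide +kernel)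
    (by simp [Set.insert_subset_iff, hexad])
    fun _ ha => mem_closure_of_mem_decad (hexad_subset_decad _ _ ha)

lemma coe_closure_flagZero_flagOne :
    (Subgroup.closure {flagZero, flagOne} : Set AltFiveProd) = decad flagZero flagOne :=
  Subgroup.coe_closure_eq_finset _ (by decide +kernel) (by decide +kernel)
    (by simp [Set.insert_subset_iff, decad])
    fun _ ha => mem_closure_of_mem_decad ha

lemma coe_closure_flagTwo :
    (Subgroup.closure {flagTwo} : Set AltFiveProd) = ({1, flagTwo} : Finset AltFiveProd) := by
  refine Subgroup.coe_closure_eq_finset _ (by decide +kernel) (by decide +kernel) (by simp)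
    fun a ha => ?_
  simp only [Finset.mem_insert, Finset.mem_singleton] at ha
  rcases ha with rfl | rfl
  · exact one_mem _
  · exact Subgroup.subset_closure rfl

lemma Subgroup.index_eq_of_card {H : Subgroup AltFiveProd} {m n : ℕ} (hm : Nat.card H = m)
    (hn : m * n = 120) : H.index = n := by
  have h := H.card_mul_index
  rw [hm, card_altFiveProd, ← hn] at h
  exact Nat.eq_of_mul_eq_mul_left (by grind) h

/-- The double transposition `(2 4)(3 5)`, on the letters `0, …, 4`. -/
def kleinLeft : AltFiveProd :=
  (⟨Equiv.swap 1 3 * Equiv.swap 2 4, Equiv.Perm.mem_alternatingGroup.2 (by decide +kernel)⟩, 1)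

/-- The double transposition `(2 5)(3 4)`, on the letters `0, …, 4`. -/
def kleinRight : AltFiveProd :=
  (⟨Equiv.swap 1 4 * Equiv.swap 2 3, Equiv.Perm.mem_alternatingGroup.2 (by decide +kernel)⟩, 1)

lemma kleinLeft_eq : kleinLeft = flagZero * flagTwo * (flagOne * flagTwo) * (flagOne * flagTwo) *
    (flagZero * flagTwo) * (flagOne * flagTwo) := by
  decide +kernel

lemma kleinRight_eq : kleinRight = flagOne * flagTwo * (flagOne * flagTwo) *
    (flagZero * flagTwo) * (flagOne * flagTwo) * (flagZero * flagTwo) := by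
  decide +kernel

lemma card_closure_klein : Nat.card (Subgroup.closure {kleinLeft, kleinRight}) = 4 :=
  Subgroup.card_closure_eq_finset_card (S := {1, kleinLeft, kleinRight, kleinLeft * kleinRight})
    (Subgroup.coe_closure_eq_finset _ (by decide +kernel) (by decide +kernel)
      (by simp [Set.insert_subset_iff]) fun a ha => mem_closure_of_mem_decad (by
        simp only [decad, Finset.mem_insert, Finset.mem_singleton] at ha ⊢
        tauto))

lemma flagZero_notMem_closure_even_words :
    flagZero ∉ Subgroup.closure {flagZero * flagTwo, flagOne * flagTwo} := by
  have h_le : Subgroup.closure {flagZero * flagTwo, flagOne * flagTwo} ≤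
      (MonoidHom.snd (alternatingGroup (Fin 5)) (Multiplicative (ZMod 2))).ker := by
    rw [Subgroup.closure_le]
    rintro _ (rfl | rfl) <;> exact MonoidHom.mem_ker.2 (by decide +kernel)
  exact fun h => absurd (MonoidHom.mem_ker.1 (h_le h)) (by decide +kernel)

/-- The words of even length form the subgroup `A₅ × 1`. -/
lemma card_closure_even_words :
    Nat.card (Subgroup.closure {flagZero * flagTwo, flagOne * flagTwo}) = 60 := by
  set E := Subgroup.closure {flagZero * flagTwo, flagOne * flagTwo}
  have hu : flagZero * flagTwo ∈ E := Subgroup.subset_closure (by simp)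
  have hv : flagOne * flagTwo ∈ E := Subgroup.subset_closure (by simp)
  have h_three : 3 ∣ Nat.card E :=
    orderOf_flagZero_mul_flagTwo.symm.dvd.trans (E.orderOf_dvd_natCard hu)
  have h_five : 5 ∣ Nat.card E := by
    have hw : flagZero * flagOne ∈ E := by
      have : flagZero * flagOne = flagZero * flagTwo * (flagOne * flagTwo)⁻¹ := by decide +kernel
      rw [this]
      exact mul_mem hu (inv_mem hv)
    exact orderOf_flagZero_mul_flagOne.symm.dvd.trans (E.orderOf_dvd_natCard hw)
  have h_four : 4 ∣ Nat.card E := by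
    have hx : kleinLeft ∈ E :=
      kleinLeft_eq ▸ mul_mem (mul_mem (mul_mem (mul_mem hu hv) hv) hu) hv
    have hy : kleinRight ∈ E :=
      kleinRight_eq ▸ mul_mem (mul_mem (mul_mem (mul_mem hv hv) hu) hv) hu
    rw [← card_closure_klein]
    exact Subgroup.card_dvd_of_le
      ((Subgroup.closure_le _).2 (by simp [Set.insert_subset_iff, hx, hy]))
  have h_dvd : 60 ∣ Nat.card E := by omega
  have h_ne : Nat.card E ≠ 120 := fun h => by
    rw [← card_altFiveProd] at h
    exact flagZero_notMem_closure_even_words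
      ((Subgroup.eq_top_of_card_eq E h).ge (Subgroup.mem_top _))
  have h_dvd' : Nat.card E ∣ 120 := card_altFiveProd ▸ E.card_subgroup_dvd_card
  have := Nat.le_of_dvd (by norm_num) h_dvd'
  have : 0 < Nat.card E := Nat.card_pos
  omega

lemma closure_flags :
    Subgroup.closure {flagZero, flagOne, flagTwo} = (⊤ : Subgroup AltFiveProd) := by
  set K := Subgroup.closure {flagZero, flagOne, flagTwo}
  set E := Subgroup.closure {flagZero * flagTwo, flagOne * flagTwo} with hE
  have h₀ : flagZero ∈ K := Subgroup.subset_closure (by simp)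
  have h₁ : flagOne ∈ K := Subgroup.subset_closure (by simp)
  have h₂ : flagTwo ∈ K := Subgroup.subset_closure (by simp)
  have h_le : E ≤ K := by
    rw [hE, Subgroup.closure_le]
    rintro _ (rfl | rfl)
    exacts [mul_mem h₀ h₂, mul_mem h₁ h₂]
  have h_dvd : 60 ∣ Nat.card K := card_closure_even_words ▸ Subgroup.card_dvd_of_le h_le
  have h_ne : Nat.card K ≠ 60 := fun h => by
    have h_eq : E = K := Subgroup.eq_of_le_of_card_ge h_le (by rw [h, card_closure_even_words])
    exact flagZero_notMem_closure_even_words (h_eq.ge h₀)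
  have h_dvd' : Nat.card K ∣ 120 := card_altFiveProd ▸ K.card_subgroup_dvd_card
  have := Nat.le_of_dvd (by norm_num) h_dvd'
  have : 0 < Nat.card K := Nat.card_pos
  exact Subgroup.eq_top_of_card_eq K (by rw [card_altFiveProd]; omega)

lemma isRLHTriple_flags : IsRLHTriple flagZero flagOne flagTwo := by
  refine ⟨orderOf_flagZero, orderOf_flagOne, orderOf_flagTwo, by decide +kernel,
    by decide +kernel, by decide +kernel, closure_flags, ?_, ?_⟩
  · apply SetLike.coe_injective
    rw [Subgroup.coe_inf, coe_closure_flagOne_flagTwo, coe_closure_flagZero_flagTwo,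
      coe_closure_flagTwo, ← Finset.coe_inter]
    exact congrArg _ (by decide +kernel)
  · rw [coe_closure_flagOne_flagTwo, coe_closure_flagZero_flagTwo, ← Finset.coe_mul,
      ← Finset.coe_mul, ← Finset.coe_inter, ← Finset.coe_union]
    exact congrArg _ (by decide +kernel)

theorem stmt_16
    (r₀ r₁ r₂ : alternatingGroup (Fin 5) × Multiplicative (ZMod 2))
    (hr₀ : r₀ = (⟨Equiv.swap 0 2 * Equiv.swap 1 3, by simp [Equiv.Perm.mem_alternatingGroup]⟩, Multiplicative.ofAdd 1))
    (hr₁ : r₁ = (⟨Equiv.swap 0 1 * Equiv.swap 3 4, by simp [Equiv.Perm.mem_alternatingGroup]⟩, Multiplicative.ofAdd 1))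
    (hr₂ : r₂ = (⟨Equiv.swap 0 2 * Equiv.swap 3 4, by simp [Equiv.Perm.mem_alternatingGroup]⟩, Multiplicative.ofAdd 1)) :
    IsRLHTriple r₀ r₁ r₂ ∧
    orderOf (r₁ * r₂) = 3 ∧ orderOf (r₀ * r₂) = 3 ∧ orderOf (r₀ * r₁) = 5 ∧
    (Subgroup.closure {r₁, r₂}).index = 20 ∧
    (Subgroup.closure {r₀, r₂}).index = 20 ∧
    (Subgroup.closure {r₀, r₁}).index = 12 ∧
    (Subgroup.closure {r₀ * r₂, r₁ * r₂}).index = 2 := by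
  obtain rfl : r₀ = flagZero := hr₀
  obtain rfl : r₁ = flagOne := hr₁
  obtain rfl : r₂ = flagTwo := hr₂
  refine ⟨isRLHTriple_flags, orderOf_flagOne_mul_flagTwo, orderOf_flagZero_mul_flagTwo,
    orderOf_flagZero_mul_flagOne, ?_, ?_, ?_, ?_⟩
  · exact Subgroup.index_eq_of_card (m := 6)
      (Subgroup.card_closure_eq_finset_card coe_closure_flagOne_flagTwo) (by norm_num)
  · exact Subgroup.index_eq_of_card (m := 6)
      (Subgroup.card_closure_eq_finset_card coe_closure_flagZero_flagTwo) (by norm_num)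
  · exact Subgroup.index_eq_of_card (m := 10)
      (Subgroup.card_closure_eq_finset_card coe_closure_flagZero_flagOne) (by norm_num)
  · exact Subgroup.index_eq_of_card card_closure_even_words (by norm_num)
end

section
/- Let G = S₄ be the symmetric group on {1,2,3,4}, and set r₀ = (1 3), r₁ = (1 2), r₂ = (3 4). Then (r₀, r₁, r₂) is a regular linear hypermap triple for G; the orders of r₁r₂, r₀r₂, r₀r₁ are 2, 3, 3 respectively; the subgroups ⟨r₁,r₂⟩, ⟨r₀,r₂⟩, ⟨r₀,r₁⟩ have indices 6, 4, 4 in G respectively; and ⟨r₀r₂, r₁r₂⟩ has index 2 in G. -/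
open Pointwise

/-- A set containing `1` and `X` that is stable under left multiplication by the involutions in `X`
contains the subgroup generated by `X`. -/
theorem closure_subset_of_involutions {G : Type*} [Group G] {X S : Set G}
    (hX : ∀ a ∈ X, a * a = 1) (h1 : 1 ∈ S) (hS : ∀ a ∈ X, ∀ x ∈ S, a * x ∈ S) :
    (Subgroup.closure X : Set G) ⊆ S := by
  intro x hx
  induction hx using Subgroup.closure_induction_left with
  | one => exact h1
  | mul_left a ha y _ hy => exact hS a ha y hy
  | inv_mul_cancel a ha y _ hy =>
    rw [inv_eq_of_mul_eq_one_left (hX a ha)]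
    exact hS a ha y hy

theorem coe_closure_singleton_of_involution {G : Type*} [Group G] {a : G} (ha : a * a = 1) :
    (Subgroup.closure {a} : Set G) = {1, a} := by
  apply Set.Subset.antisymm
  · apply closure_subset_of_involutions <;> simp [ha]
  · rintro x (rfl | rfl)
    · exact one_mem _
    · exact Subgroup.mem_closure_singleton_self _

theorem coe_closure_pair_of_commuting_involutions {G : Type*} [Group G] {a b : G}
    (ha : a * a = 1) (hb : b * b = 1) (hab : a * b = b * a) :
    (Subgroup.closure {a, b} : Set G) = {1, a, b, a * b} := by
  have hA : a ∈ Subgroup.closure {a, b} := Subgroup.subset_closure (by simp)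
  have hB : b ∈ Subgroup.closure {a, b} := Subgroup.subset_closure (by simp)
  apply Set.Subset.antisymm
  · apply closure_subset_of_involutions
    · simp [ha, hb]
    · simp
    · have hbab : b * (a * b) = a := by rw [hab, ← mul_assoc, hb, one_mul]
      have haab : a * (a * b) = b := by rw [← mul_assoc, ha, one_mul]
      rintro x (rfl | rfl) y (rfl | rfl | rfl | rfl) <;>
        simp only [mul_one, Set.mem_insert_iff, Set.mem_singleton_iff, true_or, or_true,
          ha, hb, hbab, haab, ← hab]
  · rintro x (rfl | rfl | rfl | rfl)
    exacts [one_mem _, hA, hB, mul_mem hA hB]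

/-- Two involutions satisfying the braid relation generate a dihedral group with at most six
elements. -/
theorem coe_closure_pair_of_braid_involutions {G : Type*} [Group G] {a b : G}
    (ha : a * a = 1) (hb : b * b = 1) (hab : a * b * a = b * a * b) :
    (Subgroup.closure {a, b} : Set G) = {1, a, b, a * b, b * a, a * b * a} := by
  have hA : a ∈ Subgroup.closure {a, b} := Subgroup.subset_closure (by simp)
  have hB : b ∈ Subgroup.closure {a, b} := Subgroup.subset_closure (by simp)
  apply Set.Subset.antisymm
  · apply closure_subset_of_involutions
    · simp [ha, hb]
    · simp
    · have h1 : a * (a * b) = b := by rw [← mul_assoc, ha, one_mul]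
      have h2 : b * (b * a) = a := by rw [← mul_assoc, hb, one_mul]
      have h3 : a * (a * b * a) = b * a := by rw [mul_assoc a b a, ← mul_assoc, ha, one_mul]
      have h4 : b * (a * b * a) = a * b := by
        rw [hab, mul_assoc b a b, ← mul_assoc, hb, one_mul]
      have h5 : a * (b * a) = a * b * a := (mul_assoc a b a).symm
      have h6 : b * (a * b) = a * b * a := by rw [hab, mul_assoc b a b]
      rintro x (rfl | rfl) y (rfl | rfl | rfl | rfl | rfl | rfl) <;>
        simp only [mul_one, Set.mem_insert_iff, Set.mem_singleton_iff, true_or, or_true,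
          ha, hb, h1, h2, h3, h4, h5, h6]
  · rintro x (rfl | rfl | rfl | rfl | rfl | rfl)
    exacts [one_mem _, hA, hB, mul_mem hA hB, mul_mem hB hA, mul_mem (mul_mem hA hB) hA]

theorem Subgroup.index_eq_of_coe_eq_finset {G : Type*} [Group G] [Finite G] {H : Subgroup G}
    {s : Finset G} {n : ℕ} (hs : (H : Set G) = s) (hn : s.card * n = Nat.card G) :
    H.index = n := by
  have hH : Nat.card H = s.card := by
    rw [← Set.ncard_coe_finset, ← hs]
    rfl
  have hpos : 0 < s.card := hH ▸ Nat.card_pos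
  apply Nat.eq_of_mul_eq_mul_left hpos
  rw [hn, ← hH, H.card_mul_index]

open Equiv in
theorem closure_three_swaps_eq_top :
    Subgroup.closure {swap (0 : Fin 4) 2, swap 0 1, swap 2 3} = ⊤ := by
  set H := Subgroup.closure {swap (0 : Fin 4) 2, swap 0 1, swap 2 3} with hH
  have h02 : swap (0 : Fin 4) 2 ∈ H := Subgroup.subset_closure (by simp)
  have h01 : swap (0 : Fin 4) 1 ∈ H := Subgroup.subset_closure (by simp)
  have h23 : swap (2 : Fin 4) 3 ∈ H := Subgroup.subset_closure (by simp)
  have h12 : swap (1 : Fin 4) 2 ∈ H := by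
    have h : swap (1 : Fin 4) 2 = swap 0 1 * swap 0 2 * swap 0 1 := by decide
    exact h ▸ mul_mem (mul_mem h01 h02) h01
  have hle : (⊤ : Submonoid (Perm (Fin 4))) ≤ H.toSubmonoid := by
    rw [← Perm.mclosure_swap_castSucc_succ 3, Submonoid.closure_le]
    rintro _ ⟨i, rfl⟩
    fin_cases i
    exacts [h01, h12, h23]
  exact eq_top_iff.2 fun x _ => hle (Submonoid.mem_top x)

open Equiv in
theorem closure_even_products_eq_alternatingGroup :
    Subgroup.closure {swap (0 : Fin 4) 2 * swap 2 3, swap 0 1 * swap 2 3} =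
      alternatingGroup (Fin 4) := by
  apply le_antisymm
  · rw [Subgroup.closure_le]
    rintro _ (rfl | rfl) <;> exact Perm.mem_alternatingGroup.2 (by decide)
  · intro x hx
    have key : ∀ x : Perm (Fin 4), Perm.sign x = 1 → ∃ i j k : Fin 3,
        x = (swap 0 2 * swap 2 3) ^ (i : ℕ) * (swap 0 1 * swap 2 3) ^ (j : ℕ) *
          (swap 0 2 * swap 2 3) ^ (k : ℕ) := by decide
    obtain ⟨i, j, k, rfl⟩ := key x hx
    exact mul_mem (mul_mem (pow_mem (Subgroup.subset_closure (by simp)) _)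
      (pow_mem (Subgroup.subset_closure (by simp)) _))
      (pow_mem (Subgroup.subset_closure (by simp)) _)

theorem stmt_18 (r₀ r₁ r₂ : Equiv.Perm (Fin 4))
    (hr₀ : r₀ = Equiv.swap 0 2) (hr₁ : r₁ = Equiv.swap 0 1) (hr₂ : r₂ = Equiv.swap 2 3) :
    IsRLHTriple r₀ r₁ r₂ ∧
    orderOf (r₁ * r₂) = 2 ∧ orderOf (r₀ * r₂) = 3 ∧ orderOf (r₀ * r₁) = 3 ∧
    (Subgroup.closure {r₁, r₂}).index = 6 ∧
    (Subgroup.closure {r₀, r₂}).index = 4 ∧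
    (Subgroup.closure {r₀, r₁}).index = 4 ∧
    (Subgroup.closure {r₀ * r₂, r₁ * r₂}).index = 2 := by
  subst hr₀ hr₁ hr₂
  have hcard : Nat.card (Equiv.Perm (Fin 4)) = 24 := by
    rw [Nat.card_eq_fintype_card, Fintype.card_perm, Fintype.card_fin]
    rfl
  have h2 : (Subgroup.closure {Equiv.swap (2 : Fin 4) 3} :
      Set (Equiv.Perm (Fin 4))) =
      ({1, Equiv.swap 2 3} : Finset (Equiv.Perm (Fin 4))) := by
    rw [coe_closure_singleton_of_involution (by decide)]
    push_cast
    rfl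
  have h12 : (Subgroup.closure {Equiv.swap (0 : Fin 4) 1, Equiv.swap 2 3} :
      Set (Equiv.Perm (Fin 4))) =
      ({1, Equiv.swap 0 1, Equiv.swap 2 3, Equiv.swap 0 1 * Equiv.swap 2 3} :
        Finset (Equiv.Perm (Fin 4))) := by
    rw [coe_closure_pair_of_commuting_involutions (by decide) (by decide) (by decide)]
    push_cast
    rfl
  have h02 : (Subgroup.closure {Equiv.swap (0 : Fin 4) 2, Equiv.swap 2 3} :
      Set (Equiv.Perm (Fin 4))) =
      (Finset.univ.filter fun x => x 1 = 1 : Finset (Equiv.Perm (Fin 4))) := by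
    rw [coe_closure_pair_of_braid_involutions (by decide) (by decide) (by decide)]
    ext x
    simp only [Set.mem_insert_iff, Set.mem_singleton_iff, Finset.coe_filter, Finset.mem_univ,
      true_and, Set.mem_ofPred_eq]
    revert x
    decide
  have h01 : (Subgroup.closure {Equiv.swap (0 : Fin 4) 2, Equiv.swap 0 1} :
      Set (Equiv.Perm (Fin 4))) =
      (Finset.univ.filter fun x => x 3 = 3 : Finset (Equiv.Perm (Fin 4))) := by
    rw [coe_closure_pair_of_braid_involutions (by decide) (by decide) (by decide)]
    ext x
    simp only [Set.mem_insert_iff, Set.mem_singleton_iff, Finset.coe_filter, Finset.mem_univ,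
      true_and, Set.mem_ofPred_eq]
    revert x
    decide
  refine ⟨⟨?_, ?_, ?_, by decide, by decide, by decide, closure_three_swaps_eq_top, ?_, ?_⟩,
    ?_, ?_, ?_, ?_, ?_, ?_, ?_⟩
  · exact orderOf_eq_prime (by decide) (by decide)
  · exact orderOf_eq_prime (by decide) (by decide)
  · exact orderOf_eq_prime (by decide) (by decide)
  · apply SetLike.coe_injective
    rw [Subgroup.coe_inf, h12, h02, h2, ← Finset.coe_inter]
    exact congrArg _ (by decide)
  · rw [h12, h02, ← Finset.coe_mul, ← Finset.coe_mul, ← Finset.coe_inter, ← Finset.coe_union]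
    exact congrArg _ (by decide)
  · exact orderOf_eq_prime (by decide) (by decide)
  · exact orderOf_eq_prime (by decide) (by decide)
  · exact orderOf_eq_prime (by decide) (by decide)
  · exact Subgroup.index_eq_of_coe_eq_finset h12 (hcard ▸ by decide)
  · exact Subgroup.index_eq_of_coe_eq_finset h02 (hcard ▸ by decide)
  · exact Subgroup.index_eq_of_coe_eq_finset h01 (hcard ▸ by decide)
  · rw [closure_even_products_eq_alternatingGroup]
    exact alternatingGroup.index_eq_two
end
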